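/- Let b>0, p≥2, ε>0 and 0<β₁<1/(p−1). Set f(s):=|s|^{β₁−1}s and g(s):=(p−1)|s|^{p−2}+ε. If u₀ satisfies (B1) or (B2), then there exists a viscosity solution u:(−b,b)×[0,∞)→ℝ, globally in time, of the initial value problem u_t − f(g(u_x)u_{xx}) = 0 in Q (i.e. the p-Laplace type heat equation u_t = |Δ_p u + εΔu|^{β₁−1}(Δ_p u + εΔu)), with the singular Dirichlet condition lim_{x→±b}u(x,t)=∞ for every t>0, and initial datum u₀. -/

import Mathlib

open Filter Set Topology

noncomputable section

/-- The parabolic cylinder `Q = (-b,b) × (0,∞)`. -/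
def Qset (b : ℝ) : Set (ℝ × ℝ) := Ioo (-b) b ×ˢ Ioi (0:ℝ)

/-- The cylinder `Q₀ = (-b,b) × [0,∞)`. -/
def Q0set (b : ℝ) : Set (ℝ × ℝ) := Ioo (-b) b ×ˢ Ici (0:ℝ)

/-- Partial derivative in time. -/
def pT (φ : ℝ × ℝ → ℝ) (p : ℝ × ℝ) : ℝ := deriv (fun t => φ (p.1, t)) p.2

/-- Partial derivative in space. -/
def pX (φ : ℝ × ℝ → ℝ) (p : ℝ × ℝ) : ℝ := deriv (fun x => φ (x, p.2)) p.1

/-- Second partial derivative in space. -/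
def pXX (φ : ℝ × ℝ → ℝ) (p : ℝ × ℝ) : ℝ := deriv (fun x => pX φ (x, p.2)) p.1

/-- (A1): `f` is continuous, strictly increasing, `f 0 = 0`, `f(s) → ±∞` as `s → ±∞`. -/
def A1 (f : ℝ → ℝ) : Prop :=
  Continuous f ∧ StrictMono f ∧ f 0 = 0 ∧ Tendsto f atTop atTop ∧ Tendsto f atBot atBot

/-- (A2) with exponent `α`: `g` is continuous, positive, and `|s|^α g(s)` has positive
limits as `s → ±∞`. -/
def A2 (g : ℝ → ℝ) (α : ℝ) : Prop :=
  Continuous g ∧ (∀ s, 0 < g s) ∧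
  ∃ Cgp Cgm : ℝ, 0 < Cgp ∧ 0 < Cgm ∧
    Tendsto (fun s => |s| ^ α * g s) atTop (𝓝 Cgp) ∧
    Tendsto (fun s => |s| ^ α * g s) atBot (𝓝 Cgm)

/-- (A3) with exponent `β > 0`: `|s|^(-β) f s → ±C_{f±}` as `s → ±∞`. -/
def A3 (f : ℝ → ℝ) (β : ℝ) : Prop :=
  0 < β ∧ ∃ Cfp Cfm : ℝ, 0 < Cfp ∧ 0 < Cfm ∧
    Tendsto (fun s => |s| ^ (-β) * f s) atTop (𝓝 Cfp) ∧
    Tendsto (fun s => |s| ^ (-β) * f s) atBot (𝓝 (-Cfm))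

/-- (B1): `u₀ ∈ C([-b,b])`. -/
def B1 (b : ℝ) (u0 : ℝ → ℝ) : Prop := ContinuousOn u0 (Icc (-b) b)

/-- (B2): `u₀ ∈ C((-b,b))`, diverging to `∞` at `±b` with polynomial rate bound. -/
def B2 (b : ℝ) (u0 : ℝ → ℝ) : Prop :=
  ContinuousOn u0 (Ioo (-b) b) ∧
  Tendsto u0 (𝓝[<] b) atTop ∧ Tendsto u0 (𝓝[>] (-b)) atTop ∧
  ∃ γ : ℝ, 0 < γ ∧
    (∃ C : ℝ, ∀ᶠ x in 𝓝[<] b, u0 x * (b - x) ^ γ ≤ C) ∧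
    (∃ C : ℝ, ∀ᶠ x in 𝓝[>] (-b), u0 x * (b + x) ^ γ ≤ C)

/-- `ψ_γ(s) = s^(-γ)` for `γ > 0` and `ψ₀(s) = -log s`. -/
def psi (γ : ℝ) (s : ℝ) : ℝ := if 0 < γ then s ^ (-γ) else -Real.log s

/-- (B3): `u₀ ∈ C((-b,b))` behaves like `D₊ ψ_{γ₊}(b-x)` near `b` and like
`D₋ ψ_{γ₋}(b+x)` near `-b`, up to constants. -/
def B3 (b : ℝ) (u0 : ℝ → ℝ) (γp γm Dp Dm : ℝ) : Prop :=
  ContinuousOn u0 (Ioo (-b) b) ∧ 0 ≤ γp ∧ 0 ≤ γm ∧ 0 < Dp ∧ 0 < Dm ∧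
  ∃ Cp Cm : ℝ,
    Tendsto (fun x => u0 x - Dp * psi γp (b - x)) (𝓝[<] b) (𝓝 Cp) ∧
    Tendsto (fun x => u0 x - Dm * psi γm (b + x)) (𝓝[>] (-b)) (𝓝 Cm)

/-- Viscosity sub-solution of `u_t - f(g(u_x) u_{xx}) = 0` in `Q`. -/
def IsSubSol (b : ℝ) (f g : ℝ → ℝ) (u : ℝ × ℝ → ℝ) : Prop :=
  UpperSemicontinuousOn u (Q0set b) ∧
  ∀ φ : ℝ × ℝ → ℝ, ContDiffOn ℝ 2 φ (Qset b) →
    ∀ p ∈ Qset b, IsLocalMaxOn (fun q => u q - φ q) (Qset b) p →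
      pT φ p - f (g (pX φ p) * pXX φ p) ≤ 0

/-- The singular Dirichlet boundary condition at time `t`:
`v(x,t) → ∞` as `x → ±b`. -/
def SingularBC (b : ℝ) (v : ℝ × ℝ → ℝ) (t : ℝ) : Prop :=
  Tendsto (fun x => v (x, t)) (𝓝[<] b) atTop ∧
  Tendsto (fun x => v (x, t)) (𝓝[>] (-b)) atTop

/-- Viscosity super-solution of `u_t - f(g(u_x) u_{xx}) = 0` in `Q` together with the
singular Dirichlet boundary condition. -/
def IsSuperSol (b : ℝ) (f g : ℝ → ℝ) (v : ℝ × ℝ → ℝ) : Prop :=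
  LowerSemicontinuousOn v (Q0set b) ∧
  (∀ φ : ℝ × ℝ → ℝ, ContDiffOn ℝ 2 φ (Qset b) →
    ∀ p ∈ Qset b, IsLocalMinOn (fun q => v q - φ q) (Qset b) p →
      0 ≤ pT φ p - f (g (pX φ p) * pXX φ p)) ∧
  (∀ t : ℝ, 0 < t → SingularBC b v t)

/-- Upper semicontinuous envelope relative to `Q₀`. -/
def uscEnv (b : ℝ) (u : ℝ × ℝ → ℝ) (p : ℝ × ℝ) : ℝ := limsup u (𝓝[Q0set b] p)

/-- Lower semicontinuous envelope relative to `Q₀`. -/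
def lscEnv (b : ℝ) (u : ℝ × ℝ → ℝ) (p : ℝ × ℝ) : ℝ := liminf u (𝓝[Q0set b] p)

/-- Viscosity solution of the initial value problem: `u*` is a sub-solution, `u_*` is a
super-solution (including the singular Dirichlet condition), and both envelopes agree
with `u₀` at `t = 0`. -/
def IsVSol (b : ℝ) (f g : ℝ → ℝ) (u0 : ℝ → ℝ) (u : ℝ × ℝ → ℝ) : Prop :=
  IsSubSol b f g (uscEnv b u) ∧ IsSuperSol b f g (lscEnv b u) ∧
  ∀ x ∈ Ioo (-b) b, uscEnv b u (x, 0) = u0 x ∧ lscEnv b u (x, 0) = u0 x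


/-! ### Envelopes -/

theorem isOpen_Qset (b : ℝ) : IsOpen (Qset b) := isOpen_Ioo.prod isOpen_Ioi

theorem Qset_sub (b : ℝ) : Qset b ⊆ Q0set b := by
  rintro ⟨x, t⟩ ⟨h1, h2⟩
  exact ⟨h1, show (0:ℝ) ≤ t from le_of_lt h2⟩

theorem nhdsWithin_Q0 {b : ℝ} {p : ℝ × ℝ} (hp : p ∈ Qset b) : 𝓝[Q0set b] p = 𝓝 p :=
  nhdsWithin_eq_nhds.2 (mem_of_superset ((isOpen_Qset b).mem_nhds hp) (Qset_sub b))

theorem lscEnv_eq (b : ℝ) (u : ℝ × ℝ → ℝ) (p : ℝ × ℝ) :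
    lscEnv b u p = - uscEnv b (fun q => - u q) p := by
  unfold lscEnv uscEnv
  rw [liminf_eq, limsup_eq, Real.sInf_def, neg_neg]
  congr 1
  ext a
  simp

/-- local boundedness on `Q₀` -/
def LocBdd (b : ℝ) (u : ℝ × ℝ → ℝ) : Prop :=
  ∀ p ∈ Q0set b, ∃ C : ℝ, ∀ᶠ q in 𝓝[Q0set b] p, |u q| ≤ C

theorem LocBdd.neg {b : ℝ} {u : ℝ × ℝ → ℝ} (h : LocBdd b u) : LocBdd b (fun q => - u q) := by
  intro p hp
  obtain ⟨C, hC⟩ := h p hp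
  exact ⟨C, by simpa using hC⟩

theorem LocBdd.of_sandwich {b : ℝ} {u v w : ℝ × ℝ → ℝ} (hv : ContinuousOn v (Q0set b))
    (hw : ContinuousOn w (Q0set b)) (h1 : ∀ q ∈ Q0set b, v q ≤ u q)
    (h2 : ∀ q ∈ Q0set b, u q ≤ w q) : LocBdd b u := by
  intro p hp
  refine ⟨max (|v p| + 1) (|w p| + 1), ?_⟩
  have e1 : ∀ᶠ q in 𝓝[Q0set b] p, |v q| < |v p| + 1 :=
    ((hv p hp).abs).eventually_lt_const (by linarith)
  have e2 : ∀ᶠ q in 𝓝[Q0set b] p, |w q| < |w p| + 1 :=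
    ((hw p hp).abs).eventually_lt_const (by linarith)
  filter_upwards [e1, e2, self_mem_nhdsWithin] with q a1 a2 hq
  have := h1 q hq
  have := h2 q hq
  rw [abs_lt] at a1 a2
  rw [abs_le]
  have := le_max_left (|v p| + 1) (|w p| + 1)
  have := le_max_right (|v p| + 1) (|w p| + 1)
  constructor <;> linarith

section env
variable {b : ℝ} {u : ℝ × ℝ → ℝ} {p : ℝ × ℝ}

theorem neBot_Q0 (hp : p ∈ Q0set b) : (𝓝[Q0set b] p).NeBot := 
  mem_closure_iff_nhdsWithin_neBot.1 (subset_closure hp)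

theorem ev_lt_of_env (h : LocBdd b u) (hp : p ∈ Q0set b) {c : ℝ} (hc : uscEnv b u p < c) :
    ∀ᶠ q in 𝓝[Q0set b] p, u q < c := by
  obtain ⟨C, hC⟩ := h p hp
  refine eventually_lt_of_limsup_lt hc ?_
  exact ⟨C, by simpa using hC.mono fun q hq => (abs_le.1 hq).2⟩

theorem freq_of_env (h : LocBdd b u) (hp : p ∈ Q0set b) {c : ℝ} (hc : c < uscEnv b u p) :
    ∃ᶠ q in 𝓝[Q0set b] p, c < u q := by
  obtain ⟨C, hC⟩ := h p hp
  have := neBot_Q0 hp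
  refine frequently_lt_of_lt_limsup ?_ hc
  refine IsBoundedUnder.isCoboundedUnder_le ?_
  exact ⟨-C, by simpa using hC.mono fun q hq => (abs_le.1 hq).1⟩

theorem env_le (h : LocBdd b u) (hp : p ∈ Q0set b) {c : ℝ}
    (hc : ∀ᶠ q in 𝓝[Q0set b] p, u q ≤ c) : uscEnv b u p ≤ c := by
  by_contra hlt
  push Not at hlt
  obtain ⟨q, h1, h2⟩ := ((freq_of_env h hp hlt).and_eventually hc).exists
  linarith

theorem le_env (h : LocBdd b u) (hp : p ∈ Q0set b) : u p ≤ uscEnv b u p := by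
  by_contra hlt
  push Not at hlt
  have := (ev_lt_of_env h hp hlt).self_of_nhdsWithin hp
  exact lt_irrefl _ this

theorem env_usc (h : LocBdd b u) : UpperSemicontinuousOn (uscEnv b u) (Q0set b) := by
  intro p hp c hc
  obtain ⟨c', h1, h2⟩ := exists_between hc
  have h3 := ev_lt_of_env h hp h1
  rw [← eventually_eventually_nhdsWithin] at h3
  filter_upwards [h3, self_mem_nhdsWithin] with q hq hq0
  exact (env_le h hq0 (hq.mono fun _ => le_of_lt)).trans_lt h2

theorem env_le_cont {w : ℝ × ℝ → ℝ} (h : LocBdd b u) (hw : ContinuousOn w (Q0set b))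
    (hle : ∀ q ∈ Q0set b, u q ≤ w q) (hp : p ∈ Q0set b) : uscEnv b u p ≤ w p := by
  refine le_of_forall_pos_le_add fun η hη => ?_
  refine env_le h hp ?_
  filter_upwards [(hw p hp).eventually_lt_const (show w p < w p + η by linarith),
    self_mem_nhdsWithin] with q h1 h2
  exact (hle q h2).trans h1.le

theorem cont_le_lscEnv {w : ℝ × ℝ → ℝ} (h : LocBdd b u) (hw : ContinuousOn w (Q0set b))
    (hle : ∀ q ∈ Q0set b, w q ≤ u q) (hp : p ∈ Q0set b) : w p ≤ lscEnv b u p := by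
  rw [lscEnv_eq]
  have := env_le_cont h.neg hw.neg (fun q hq => neg_le_neg (hle q hq)) hp
  simp only [Pi.neg_apply] at this
  linarith

theorem lscEnv_le (h : LocBdd b u) (hp : p ∈ Q0set b) : lscEnv b u p ≤ u p := by
  rw [lscEnv_eq]
  have := le_env h.neg hp
  linarith

theorem lscEnv_lsc (h : LocBdd b u) : LowerSemicontinuousOn (lscEnv b u) (Q0set b) := by
  intro p hp c hc
  rw [lscEnv_eq] at hc
  have := env_usc h.neg p hp (-c) (by linarith)
  filter_upwards [this] with q hq
  rw [lscEnv_eq]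
  linarith

end env

/-! ### Derivatives -/

section ders
variable {b : ℝ}

theorem pX_eq {φ : ℝ × ℝ → ℝ} (hφ : ContDiffOn ℝ 1 φ (Qset b)) {q : ℝ × ℝ} (hq : q ∈ Qset b) :
    pX φ q = fderiv ℝ φ q (1, 0) := by
  have hd : HasFDerivAt φ (fderiv ℝ φ q) q :=
    ((hφ.differentiableOn one_ne_zero).differentiableAt ((isOpen_Qset b).mem_nhds hq)).hasFDerivAt
  have h2 : HasDerivAt (fun x : ℝ => (x, q.2)) ((1 : ℝ), (0 : ℝ)) q.1 :=
    (hasDerivAt_id q.1).prodMk (hasDerivAt_const q.1 q.2)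
  exact (HasFDerivAt.comp_hasDerivAt (x := q.1) (f := fun x : ℝ => (x, q.2)) (l := φ) hd h2).deriv

theorem pT_eq {φ : ℝ × ℝ → ℝ} (hφ : ContDiffOn ℝ 1 φ (Qset b)) {q : ℝ × ℝ} (hq : q ∈ Qset b) :
    pT φ q = fderiv ℝ φ q (0, 1) := by
  have hd : HasFDerivAt φ (fderiv ℝ φ q) q :=
    ((hφ.differentiableOn one_ne_zero).differentiableAt ((isOpen_Qset b).mem_nhds hq)).hasFDerivAt
  have h2 : HasDerivAt (fun x : ℝ => (q.1, x)) ((0 : ℝ), (1 : ℝ)) q.2 :=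
    (hasDerivAt_const q.2 q.1).prodMk (hasDerivAt_id q.2)
  exact (HasFDerivAt.comp_hasDerivAt (x := q.2) (f := fun x : ℝ => (q.1, x)) (l := φ) hd h2).deriv

theorem cd_pX {φ : ℝ × ℝ → ℝ} (hφ : ContDiffOn ℝ 2 φ (Qset b)) : ContDiffOn ℝ 1 (pX φ) (Qset b) := by
  have h1 : ContDiffOn ℝ 1 (fderiv ℝ φ) (Qset b) :=
    hφ.fderiv_of_isOpen (isOpen_Qset b) (by norm_num)
  refine (h1.clm_apply contDiffOn_const).congr (fun q hq => pX_eq (hφ.of_le (by norm_num)) hq)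

theorem cont_pX {φ : ℝ × ℝ → ℝ} (hφ : ContDiffOn ℝ 1 φ (Qset b)) : ContinuousOn (pX φ) (Qset b) := by
  have h1 : ContinuousOn (fderiv ℝ φ) (Qset b) :=
    hφ.continuousOn_fderiv_of_isOpen (isOpen_Qset b) le_rfl
  exact (h1.clm_apply continuousOn_const).congr (fun q hq => pX_eq hφ hq)

theorem cont_pT {φ : ℝ × ℝ → ℝ} (hφ : ContDiffOn ℝ 1 φ (Qset b)) : ContinuousOn (pT φ) (Qset b) := by
  have h1 : ContinuousOn (fderiv ℝ φ) (Qset b) :=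
    hφ.continuousOn_fderiv_of_isOpen (isOpen_Qset b) le_rfl
  exact (h1.clm_apply continuousOn_const).congr (fun q hq => pT_eq hφ hq)

theorem cont_pXX {φ : ℝ × ℝ → ℝ} (hφ : ContDiffOn ℝ 2 φ (Qset b)) : ContinuousOn (pXX φ) (Qset b) :=
  cont_pX (cd_pX hφ)

theorem diff_sliceX {φ : ℝ × ℝ → ℝ} (hφ : ContDiffOn ℝ 1 φ (Qset b)) {q : ℝ × ℝ} (hq : q ∈ Qset b) :
    DifferentiableAt ℝ (fun x => φ (x, q.2)) q.1 := by
  have hd : DifferentiableAt ℝ φ (q.1, q.2) :=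
    ((hφ.differentiableOn one_ne_zero).differentiableAt ((isOpen_Qset b).mem_nhds hq))
  exact DifferentiableAt.comp (f := fun x : ℝ => (x, q.2)) q.1 hd (by fun_prop)

theorem diff_sliceT {φ : ℝ × ℝ → ℝ} (hφ : ContDiffOn ℝ 1 φ (Qset b)) {q : ℝ × ℝ} (hq : q ∈ Qset b) :
    DifferentiableAt ℝ (fun x => φ (q.1, x)) q.2 := by
  have hd : DifferentiableAt ℝ φ (q.1, q.2) :=
    ((hφ.differentiableOn one_ne_zero).differentiableAt ((isOpen_Qset b).mem_nhds hq))
  exact DifferentiableAt.comp (f := fun x : ℝ => (q.1, x)) q.2 hd (by fun_prop)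

theorem pX_add {φ ψ : ℝ × ℝ → ℝ} (hφ : ContDiffOn ℝ 1 φ (Qset b)) (hψ : ContDiffOn ℝ 1 ψ (Qset b))
    {q : ℝ × ℝ} (hq : q ∈ Qset b) : pX (fun z => φ z + ψ z) q = pX φ q + pX ψ q :=
  deriv_fun_add (diff_sliceX hφ hq) (diff_sliceX hψ hq)

theorem pT_add {φ ψ : ℝ × ℝ → ℝ} (hφ : ContDiffOn ℝ 1 φ (Qset b)) (hψ : ContDiffOn ℝ 1 ψ (Qset b))
    {q : ℝ × ℝ} (hq : q ∈ Qset b) : pT (fun z => φ z + ψ z) q = pT φ q + pT ψ q :=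
  deriv_fun_add (diff_sliceT hφ hq) (diff_sliceT hψ hq)

theorem slice_ev {q : ℝ × ℝ} (hq : q ∈ Qset b) : ∀ᶠ x in 𝓝 q.1, (x, q.2) ∈ Qset b := by
  have : ContinuousAt (fun x : ℝ => (x, q.2)) q.1 := by fun_prop
  exact this.eventually ((isOpen_Qset b).mem_nhds hq)

theorem pXX_congr {φ : ℝ × ℝ → ℝ} {D : ℝ × ℝ → ℝ} {q : ℝ × ℝ} (hq : q ∈ Qset b)
    (h : ∀ z ∈ Qset b, pX φ z = D z) : pXX φ q = pX D q := by
  refine Filter.EventuallyEq.deriv_eq ?_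
  filter_upwards [slice_ev hq] with x hx using h _ hx

theorem pXX_add {φ ψ : ℝ × ℝ → ℝ} (hφ : ContDiffOn ℝ 2 φ (Qset b)) (hψ : ContDiffOn ℝ 2 ψ (Qset b))
    {q : ℝ × ℝ} (hq : q ∈ Qset b) : pXX (fun z => φ z + ψ z) q = pXX φ q + pXX ψ q := by
  rw [pXX_congr hq (fun z hz => pX_add (hφ.of_le (by norm_num)) (hψ.of_le (by norm_num)) hz)]
  exact pX_add (cd_pX hφ) (cd_pX hψ) hq

theorem pX_neg (φ : ℝ × ℝ → ℝ) (q : ℝ × ℝ) : pX (fun z => - φ z) q = - pX φ q := deriv.fun_neg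
theorem pT_neg (φ : ℝ × ℝ → ℝ) (q : ℝ × ℝ) : pT (fun z => - φ z) q = - pT φ q := deriv.fun_neg
theorem pXX_neg (φ : ℝ × ℝ → ℝ) (q : ℝ × ℝ) : pXX (fun z => - φ z) q = - pXX φ q := by
  unfold pXX
  simp only [pX_neg]
  exact deriv.fun_neg

theorem deriv2_nonpos {h : ℝ → ℝ} {a : ℝ} (hm : IsLocalMax h a) (hc : ContinuousAt h a) :
    deriv (deriv h) a ≤ 0 := by
  by_contra hlt
  push Not at hlt
  have hmin := isLocalMin_of_deriv_deriv_pos hlt hm.deriv_eq_zero hc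
  have he : h =ᶠ[𝓝 a] fun _ => h a := by
    filter_upwards [hm, hmin] with x h1 h2 using le_antisymm h1 h2
  have h2 : deriv h =ᶠ[𝓝 a] deriv (fun _ => h a) := he.deriv
  have h3 := h2.deriv_eq
  simp at h3
  linarith

/-- second order conditions at a local maximum -/
theorem touch {φ ψ : ℝ × ℝ → ℝ} (hφ : ContDiffOn ℝ 2 φ (Qset b)) (hψ : ContDiffOn ℝ 2 ψ (Qset b))
    {q : ℝ × ℝ} (hq : q ∈ Qset b) (hm : IsLocalMax (fun z => ψ z - φ z) q) :
    pT ψ q = pT φ q ∧ pX ψ q = pX φ q ∧ pXX ψ q ≤ pXX φ q := by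
  have hφ' : ContDiffOn ℝ 2 (fun z => - φ z) (Qset b) := hφ.neg
  have hD : ContDiffOn ℝ 2 (fun z => ψ z + (- φ z)) (Qset b) := hψ.add hφ'
  have hm' : IsLocalMax (fun z => ψ z + (- φ z)) q := by simpa [sub_eq_add_neg] using hm
  have o1 : (1 : WithTop ℕ∞) ≤ 2 := by norm_num
  have eT := pT_add (hψ.of_le o1) (hφ'.of_le o1) hq
  have eX := pX_add (hψ.of_le o1) (hφ'.of_le o1) hq
  have eXX := pXX_add hψ hφ' hq
  rw [pT_neg] at eT
  rw [pX_neg] at eX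
  rw [pXX_neg] at eXX
  have cX : ContinuousAt (fun x : ℝ => (x, q.2)) q.1 := by fun_prop
  have cT : ContinuousAt (fun x : ℝ => (q.1, x)) q.2 := by fun_prop
  have mX : IsLocalMax (fun x => ψ (x, q.2) + (- φ (x, q.2))) q.1 := cX.eventually hm'
  have mT : IsLocalMax (fun x => ψ (q.1, x) + (- φ (q.1, x))) q.2 := cT.eventually hm'
  have zX : pX (fun z => ψ z + (- φ z)) q = 0 := mX.deriv_eq_zero
  have zT : pT (fun z => ψ z + (- φ z)) q = 0 := mT.deriv_eq_zero
  have zXX : pXX (fun z => ψ z + (- φ z)) q ≤ 0 := 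
    deriv2_nonpos mX (diff_sliceX (hD.of_le o1) hq).continuousAt
  refine ⟨?_, ?_, ?_⟩ <;> linarith

end ders

/-! ### Perron method -/

/-- the operator `φ_t - f(g(φ_x) φ_xx)` -/
def Eop (f g : ℝ → ℝ) (φ : ℝ × ℝ → ℝ) (q : ℝ × ℝ) : ℝ := pT φ q - f (g (pX φ q) * pXX φ q)

/-- quartic bump around `p` -/
def bmp (σ : ℝ) (p q : ℝ × ℝ) : ℝ := σ * ((q.1 - p.1) ^ 4 + (q.2 - p.2) ^ 2)

theorem bmp_cd (σ : ℝ) (p : ℝ × ℝ) (s : Set (ℝ × ℝ)) : ContDiffOn ℝ 2 (bmp σ p) s := by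
  unfold bmp
  fun_prop

theorem bmp_self (σ : ℝ) (p : ℝ × ℝ) : bmp σ p p = 0 := by simp [bmp]

theorem bmp_pT (σ : ℝ) (p : ℝ × ℝ) : pT (bmp σ p) p = 0 := by
  have h : HasDerivAt (fun t : ℝ => σ * ((p.1 - p.1) ^ 4 + (t - p.2) ^ 2))
      (σ * (2 * (p.2 - p.2) ^ 1 * 1)) p.2 := by
    have := ((((hasDerivAt_id p.2).sub_const p.2).pow 2).const_add ((p.1 - p.1) ^ 4)).const_mul σ
    simpa using this
  have := h.deriv
  simp only [sub_self] at this
  simp [pT, bmp]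

theorem bmp_pX (σ : ℝ) (p q : ℝ × ℝ) : pX (bmp σ p) q = σ * (4 * (q.1 - p.1) ^ 3) := by
  have h : HasDerivAt (fun x : ℝ => σ * ((x - p.1) ^ 4 + (q.2 - p.2) ^ 2))
      (σ * (4 * (q.1 - p.1) ^ 3)) q.1 := by
    have := ((((hasDerivAt_id q.1).sub_const p.1).pow 4).add_const ((q.2 - p.2) ^ 2)).const_mul σ
    simpa using this
  exact h.deriv

theorem bmp_pXX (σ : ℝ) (p : ℝ × ℝ) : pXX (bmp σ p) p = 0 := by
  unfold pXX
  simp only [bmp_pX]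
  have h : HasDerivAt (fun x : ℝ => σ * (4 * (x - p.1) ^ 3)) 0 p.1 := by
    have := ((((hasDerivAt_id p.1).sub_const p.1).pow 3).const_mul 4).const_mul σ
    simpa using this
  exact h.deriv

theorem bmp_lower {p q : ℝ × ℝ} {r : ℝ} (hr : 0 < r) (h : r ≤ dist q p) :
    min (r ^ 4) (r ^ 2) ≤ bmp 1 p q := by
  rw [Prod.dist_eq, le_max_iff, Real.dist_eq, Real.dist_eq] at h
  unfold bmp
  have e4 : (q.1 - p.1) ^ 4 = |q.1 - p.1| ^ 4 := by
    rw [← abs_pow, abs_of_nonneg (by positivity)]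
  rcases h with h | h
  · refine (min_le_left _ _).trans ?_
    have : r ^ 4 ≤ |q.1 - p.1| ^ 4 := pow_le_pow_left₀ hr.le h 4
    nlinarith [sq_nonneg (q.2 - p.2)]
  · refine (min_le_right _ _).trans ?_
    have : r ^ 2 ≤ |q.2 - p.2| ^ 2 := pow_le_pow_left₀ hr.le h 2
    rw [sq_abs] at this
    have : 0 ≤ (q.1 - p.1) ^ 4 := by positivity
    linarith

section perron
variable {b : ℝ} {f g : ℝ → ℝ}

theorem Eop_cont (hf : Continuous f) (hg : Continuous g) {φ : ℝ × ℝ → ℝ}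
    (hφ : ContDiffOn ℝ 2 φ (Qset b)) : ContinuousOn (Eop f g φ) (Qset b) := by
  have h1 : ContDiffOn ℝ 1 φ (Qset b) := hφ.of_le (by norm_num)
  exact (cont_pT h1).sub (hf.comp_continuousOn
    ((hg.comp_continuousOn (cont_pX h1)).mul (cont_pXX hφ)))

theorem Eop_neg (hodd : ∀ s, f (-s) = - f s) (heven : ∀ s, g (-s) = g s) (φ : ℝ × ℝ → ℝ)
    (q : ℝ × ℝ) : Eop f g (fun z => - φ z) q = - Eop f g φ q := by
  unfold Eop
  rw [pT_neg, pX_neg, pXX_neg, heven, mul_neg, hodd]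
  ring

theorem Eop_add_const (φ : ℝ × ℝ → ℝ) (c : ℝ) (q : ℝ × ℝ) :
    Eop f g (fun z => φ z + c) q = Eop f g φ q := by
  have h1 : ∀ z, pX (fun z => φ z + c) z = pX φ z := fun z => deriv_add_const _
  have h2 : pT (fun z => φ z + c) q = pT φ q := deriv_add_const _
  have h3 : pXX (fun z => φ z + c) q = pXX φ q := by
    unfold pXX
    simp only [h1]
  unfold Eop
  rw [h1, h2, h3]

theorem Eop_bmp {φ : ℝ × ℝ → ℝ} (hφ : ContDiffOn ℝ 2 φ (Qset b)) (σ : ℝ) {p : ℝ × ℝ}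
    (hp : p ∈ Qset b) : Eop f g (fun z => φ z + bmp σ p z) p = Eop f g φ p := by
  have hb2 := bmp_cd σ p (Qset b)
  have o1 : (1 : WithTop ℕ∞) ≤ 2 := by norm_num
  unfold Eop
  rw [pT_add (hφ.of_le o1) (hb2.of_le o1) hp, pX_add (hφ.of_le o1) (hb2.of_le o1) hp,
    pXX_add hφ hb2 hp, bmp_pT, bmp_pX, bmp_pXX]
  simp

theorem Eop_mono (hmono : Monotone f) (hg0 : ∀ s, 0 ≤ g s) {φ ψ : ℝ × ℝ → ℝ}
    (hφ : ContDiffOn ℝ 2 φ (Qset b)) (hψ : ContDiffOn ℝ 2 ψ (Qset b))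
    {q : ℝ × ℝ} (hq : q ∈ Qset b) (hm : IsLocalMax (fun z => ψ z - φ z) q) :
    Eop f g φ q ≤ Eop f g ψ q := by
  obtain ⟨h1, h2, h3⟩ := touch hφ hψ hq hm
  unfold Eop
  rw [h1, h2]
  have := hmono (mul_le_mul_of_nonneg_left h3 (hg0 (pX φ q)))
  linarith

theorem classical_sub (hmono : Monotone f) (hg0 : ∀ s, 0 ≤ g s) {ψ : ℝ × ℝ → ℝ}
    (hψ : ContDiffOn ℝ 2 ψ (Qset b)) (hc : ContinuousOn ψ (Q0set b))
    (hE : ∀ q ∈ Qset b, Eop f g ψ q ≤ 0) : IsSubSol b f g ψ := by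
  refine ⟨hc.upperSemicontinuousOn, fun φ hφ p hp hm => ?_⟩
  exact (Eop_mono hmono hg0 hφ hψ hp (hm.isLocalMax ((isOpen_Qset b).mem_nhds hp))).trans (hE p hp)

theorem env_mono {u v : ℝ × ℝ → ℝ} (hu : LocBdd b u) (hv : LocBdd b v)
    (h : ∀ q ∈ Q0set b, u q ≤ v q) {p : ℝ × ℝ} (hp : p ∈ Q0set b) :
    uscEnv b u p ≤ uscEnv b v p := by
  refine le_of_forall_pos_le_add fun η hη => env_le hu hp ?_
  filter_upwards [ev_lt_of_env hv hp (show uscEnv b v p < uscEnv b v p + η by linarith),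
    self_mem_nhdsWithin] with q h1 h2
  exact (h q h2).trans h1.le

theorem isSubSol_sup (hf : Continuous f) (hg : Continuous g) {F : Set (ℝ × ℝ → ℝ)}
    (hF : ∀ w ∈ F, IsSubSol b f g w) {u : ℝ × ℝ → ℝ}
    (hu : ∀ q ∈ Q0set b, IsLUB ((fun w : ℝ × ℝ → ℝ => w q) '' F) (u q)) (hl : LocBdd b u) :
    IsSubSol b f g (uscEnv b u) := by
  refine ⟨env_usc hl, fun φ hφ p hp hm => ?_⟩
  change Eop f g φ p ≤ 0
  by_contra hlt
  push Not at hlt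
  have hpn := (isOpen_Qset b).mem_nhds hp
  have hp0 := Qset_sub b hp
  replace hm := hm.isLocalMax hpn
  set U := uscEnv b u with hU
  have hcd : ContDiffOn ℝ 2 (fun z => φ z + bmp 1 p z) (Qset b) := hφ.add (bmp_cd 1 p _)
  have e1 : ∀ᶠ q in 𝓝 p, 0 < Eop f g (fun z => φ z + bmp 1 p z) q :=
    ((Eop_cont hf hg hcd).continuousAt hpn).eventually_const_lt (by rw [Eop_bmp hφ 1 hp]; exact hlt)
  obtain ⟨r, hr, hball⟩ := Metric.nhds_basis_closedBall.eventually_iff.1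
    ((e1.and hm).and hpn)
  set c := min (r ^ 4) (r ^ 2) with hc
  have hc0 : 0 < c := by positivity
  have e2 : ∀ᶠ q in 𝓝 p, φ q + bmp 1 p q < φ p + c / 2 :=
    (hcd.continuousOn.continuousAt hpn).eventually_lt_const (by simp only [bmp_self]; linarith)
  have e3 := freq_of_env hl hp0 (show U p - c / 2 < uscEnv b u p by rw [← hU]; linarith)
  rw [nhdsWithin_Q0 hp] at e3
  obtain ⟨q0, h1, h2, h3⟩ := (e3.and_eventually (e2.and (Metric.closedBall_mem_nhds p hr))).exists
  have hq0Q : q0 ∈ Q0set b := Qset_sub b (hball h3).2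
  obtain ⟨_, ⟨w, hwF, rfl⟩, hw⟩ := (lt_isLUB_iff (hu q0 hq0Q)).1 h1
  have hsubQ : Metric.closedBall p r ⊆ Qset b := fun z hz => (hball hz).2
  have husc : UpperSemicontinuousOn (fun z => w z + -(φ z + bmp 1 p z)) (Metric.closedBall p r) :=
    ((hF w hwF).1.mono (hsubQ.trans (Qset_sub b))).add
      ((hcd.continuousOn.mono hsubQ).neg.upperSemicontinuousOn)
  obtain ⟨q1, hq1, hmax⟩ := husc.exists_isMaxOn ⟨q0, h3⟩ (isCompact_closedBall p r)
  have hq1Q0 := Qset_sub b (hsubQ hq1)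
  have k1 : w q0 + -(φ q0 + bmp 1 p q0) ≤ w q1 + -(φ q1 + bmp 1 p q1) := hmax h3
  have k2 : w q1 ≤ u q1 := (hu q1 hq1Q0).1 ⟨w, hwF, rfl⟩
  have k3 : u q1 ≤ U q1 := le_env hl hq1Q0
  have k4 : U q1 - φ q1 ≤ U p - φ p := (hball hq1).1.2
  have k5 : q1 ∈ Metric.ball p r := by
    by_contra hno
    rw [Metric.mem_ball, not_lt] at hno
    have := bmp_lower hr hno
    rw [← hc] at this
    simp only at hw
    linarith
  have hloc : IsLocalMaxOn (fun q => w q - (φ q + bmp 1 p q)) (Qset b) q1 := by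
    have : ∀ᶠ z in 𝓝 q1, z ∈ Metric.ball p r := Metric.isOpen_ball.mem_nhds k5
    refine Filter.Eventually.filter_mono nhdsWithin_le_nhds ?_
    filter_upwards [this] with z hz
    have := hmax (Metric.ball_subset_closedBall hz)
    simp only [mem_ofPred_eq] at this
    linarith
  have := (hF w hwF).2 _ hcd q1 (hsubQ hq1) hloc
  have h0 := (hball hq1).1.1
  unfold Eop at h0
  linarith

theorem perron (hb : 0 < b) {u0 : ℝ → ℝ} (hf : Continuous f) (hmono : Monotone f)
    (hodd : ∀ s, f (-s) = - f s)
    (hg : Continuous g) (hg0 : ∀ s, 0 ≤ g s) (heven : ∀ s, g (-s) = g s)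
    (SP SM : Set (ℝ × ℝ → ℝ))
    (hSP : ∀ φ ∈ SP, ContDiffOn ℝ 2 φ (Qset b) ∧ ContinuousOn φ (Q0set b) ∧
      ∀ q ∈ Qset b, 0 ≤ Eop f g φ q)
    (hSM : ∀ φ ∈ SM, ContDiffOn ℝ 2 φ (Qset b) ∧ ContinuousOn φ (Q0set b) ∧
      ∀ q ∈ Qset b, Eop f g φ q ≤ 0)
    (hle : ∀ φ ∈ SP, ∀ ψ ∈ SM, ∀ q ∈ Q0set b, ψ q ≤ φ q)
    (hP : ∀ x ∈ Ioo (-b) b, ∀ η > 0, ∃ φ ∈ SP, φ (x, 0) ≤ u0 x + η)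
    (hM : ∀ x ∈ Ioo (-b) b, ∀ η > 0, ∃ ψ ∈ SM, u0 x - η ≤ ψ (x, 0))
    (hBC : ∃ ψ ∈ SM, ∀ t : ℝ, 0 < t → SingularBC b ψ t) :
    ∃ u, IsVSol b f g u0 u := by
  obtain ⟨φ0, hφ0, -⟩ := hP 0 ⟨by linarith, hb⟩ 1 one_pos
  obtain ⟨ψ0, hψ0, hψ0BC⟩ := hBC
  set F : Set (ℝ × ℝ → ℝ) := {w | IsSubSol b f g w ∧ ∀ φ ∈ SP, ∀ q ∈ Q0set b, w q ≤ φ q} with hFdef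
  have hSMF : ∀ ψ ∈ SM, ψ ∈ F := fun ψ hψ =>
    ⟨classical_sub hmono hg0 (hSM ψ hψ).1 (hSM ψ hψ).2.1 (hSM ψ hψ).2.2,
      fun φ hφ q hq => hle φ hφ ψ hψ q hq⟩
  set u : ℝ × ℝ → ℝ := fun q => sSup ((fun w : ℝ × ℝ → ℝ => w q) '' F) with hudef
  have hu : ∀ q ∈ Q0set b, IsLUB ((fun w : ℝ × ℝ → ℝ => w q) '' F) (u q) := by
    intro q hq
    refine isLUB_csSup ⟨_, ψ0, hSMF ψ0 hψ0, rfl⟩ ⟨φ0 q, ?_⟩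
    rintro _ ⟨w, hw, rfl⟩
    exact hw.2 φ0 hφ0 q hq
  have huP : ∀ φ ∈ SP, ∀ q ∈ Q0set b, u q ≤ φ q := by
    intro φ hφ q hq
    refine (hu q hq).2 ?_
    rintro _ ⟨w, hw, rfl⟩
    exact hw.2 φ hφ q hq
  have huF : ∀ w ∈ F, ∀ q ∈ Q0set b, w q ≤ u q := fun w hw q hq => (hu q hq).1 ⟨w, hw, rfl⟩
  have hul : LocBdd b u := LocBdd.of_sandwich (hSM ψ0 hψ0).2.1 (hSP φ0 hφ0).2.1
    (huF ψ0 (hSMF ψ0 hψ0)) (huP φ0 hφ0)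
  have hUsub : IsSubSol b f g (uscEnv b u) := isSubSol_sup hf hg (fun w hw => hw.1) hu hul
  have hUF : uscEnv b u ∈ F :=
    ⟨hUsub, fun φ hφ q hq => env_le_cont hul (hSP φ hφ).2.1 (huP φ hφ) hq⟩
  -- the upper obstacle
  set FF : Set (ℝ × ℝ → ℝ) := (fun φ : ℝ × ℝ → ℝ => fun z => - φ z) '' SP with hFF
  have hFFsub : ∀ w ∈ FF, IsSubSol b f g w := by
    rintro _ ⟨φ, hφ, rfl⟩
    refine classical_sub hmono hg0 (hSP φ hφ).1.neg (hSP φ hφ).2.1.neg fun q hq => ?_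
    rw [Eop_neg hodd heven]
    have := (hSP φ hφ).2.2 q hq
    linarith
  set uu : ℝ × ℝ → ℝ := fun q => sSup ((fun w : ℝ × ℝ → ℝ => w q) '' FF) with huudef
  have huu : ∀ q ∈ Q0set b, IsLUB ((fun w : ℝ × ℝ → ℝ => w q) '' FF) (uu q) := by
    intro q hq
    refine isLUB_csSup ⟨_, _, ⟨φ0, hφ0, rfl⟩, rfl⟩ ⟨-ψ0 q, ?_⟩
    rintro _ ⟨_, ⟨φ, hφ, rfl⟩, rfl⟩
    exact neg_le_neg (hle φ hφ ψ0 hψ0 q hq)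
  have huuu : ∀ q ∈ Q0set b, uu q ≤ - u q := by
    intro q hq
    refine (huu q hq).2 ?_
    rintro _ ⟨_, ⟨φ, hφ, rfl⟩, rfl⟩
    exact neg_le_neg (huP φ hφ q hq)
  have huuP : ∀ φ ∈ SP, ∀ q ∈ Q0set b, - φ q ≤ uu q := fun φ hφ q hq =>
    (huu q hq).1 ⟨_, ⟨φ, hφ, rfl⟩, rfl⟩
  have huul : LocBdd b uu := LocBdd.of_sandwich (hSP φ0 hφ0).2.1.neg (hSM ψ0 hψ0).2.1.neg
    (huuP φ0 hφ0) (fun q hq => (huuu q hq).trans (neg_le_neg (huF ψ0 (hSMF ψ0 hψ0) q hq)))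
  have hWsub : IsSubSol b f g (uscEnv b uu) := isSubSol_sup hf hg hFFsub huu huul
  set W := uscEnv b uu with hW
  set L := lscEnv b u with hL
  have hWL : ∀ q ∈ Q0set b, W q ≤ - L q := by
    intro q hq
    rw [hL, lscEnv_eq, neg_neg]
    exact env_mono huul hul.neg huuu hq
  have hx0 : ∀ x ∈ Ioo (-b) b, ((x, 0) : ℝ × ℝ) ∈ Q0set b := fun x hx => ⟨hx, le_refl (0:ℝ)⟩
  refine ⟨u, hUsub, ⟨lscEnv_lsc hul, ?_, ?_⟩, ?_⟩
  · -- supersolution property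
    intro φ hφ p hp hm
    change 0 ≤ Eop f g φ p
    by_contra hneg
    push Not at hneg
    have hpn := (isOpen_Qset b).mem_nhds hp
    have hp0 := Qset_sub b hp
    replace hm : ∀ᶠ q in 𝓝 p, L p - φ p ≤ L q - φ q := hm.isLocalMin hpn
    rcases (hWL p hp0).eq_or_lt with heq | hlt
    · have hmax : IsLocalMaxOn (fun q => W q - (- φ q)) (Qset b) p := by
        refine Filter.Eventually.filter_mono nhdsWithin_le_nhds ?_
        filter_upwards [hm, hpn] with q h1 h2
        have := hWL q (Qset_sub b h2)
        linarith
      have := hWsub.2 _ hφ.neg p hp hmax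
      change Eop f g (fun z => - φ z) p ≤ 0 at this
      rw [Eop_neg hodd heven] at this
      linarith
    · obtain ⟨m, hm1, hm2⟩ := exists_between hlt
      set k := L p - φ p with hk
      set δ0 := (- L p - m) / 2 with hδ0
      have hδ0p : 0 < δ0 := by rw [hδ0]; linarith
      have hcd : ContDiffOn ℝ 2 (fun z => φ z + bmp (-1) p z) (Qset b) := hφ.add (bmp_cd _ p _)
      have hcont := hcd.continuousOn.continuousAt hpn
      have e1 : ∀ᶠ q in 𝓝 p, Eop f g (fun z => φ z + bmp (-1) p z) q < 0 :=
        ((Eop_cont hf hg hcd).continuousAt hpn).eventually_lt_const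
          (by rw [Eop_bmp hφ _ hp]; exact hneg)
      have e2 : ∀ᶠ q in 𝓝 p, φ q + bmp (-1) p q < - m - δ0 - k :=
        hcont.eventually_lt_const (by simp only [bmp_self]; linarith)
      have e3 : ∀ᶠ q in 𝓝 p, W q < m := by
        have := env_usc huul p hp0 m hm1
        rwa [nhdsWithin_Q0 hp] at this
      obtain ⟨r, hr, hball⟩ := Metric.nhds_basis_closedBall.eventually_iff.1
        (((e1.and e2).and (e3.and hm)).and hpn)
      have hsubQ : Metric.closedBall p r ⊆ Qset b := fun z hz => (hball hz).2
      have hsubB : Metric.ball p r ⊆ Qset b := Metric.ball_subset_closedBall.trans hsubQ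
      set c := min ((r / 2) ^ 4) ((r / 2) ^ 2) with hc
      have hc0 : 0 < c := by positivity
      set δ := min δ0 (c / 2) with hδ
      have hδp : 0 < δ := lt_min hδ0p (by linarith)
      have hδ1 : δ ≤ δ0 := min_le_left _ _
      have hδ2 : δ ≤ c / 2 := min_le_right _ _
      set ψ : ℝ × ℝ → ℝ := fun z => (φ z + bmp (-1) p z) + (k + δ) with hψ
      have hψcd : ContDiffOn ℝ 2 ψ (Qset b) := hcd.add contDiffOn_const
      have hannulus : ∀ q ∈ Metric.closedBall p r, r / 2 ≤ dist q p → ψ q < u q := by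
        intro q hq hd
        have h1 := bmp_lower (half_pos hr) hd
        rw [← hc] at h1
        have h2 := (hball hq).1.2.2
        have h3 : L q ≤ u q := lscEnv_le hul (Qset_sub b (hsubQ hq))
        have h4 : bmp (-1) p q = - bmp 1 p q := by unfold bmp; ring
        simp only [hψ, h4]
        linarith
      classical
      set w : ℝ × ℝ → ℝ := fun q => if q ∈ Metric.ball p r then max (uscEnv b u q) (ψ q)
        else uscEnv b u q with hw
      have hwu : ∀ q, uscEnv b u q ≤ w q := by
        intro q
        simp only [hw]
        split_ifs
        · exact le_max_left _ _
        · exact le_rfl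
      have hwψ : ∀ q ∈ Metric.ball p r, ψ q ≤ w q := by
        intro q hq
        simp only [hw, if_pos hq]
        exact le_max_right _ _
      have hwF : w ∈ F := by
        refine ⟨⟨?_, ?_⟩, ?_⟩
        · intro q hq
          by_cases hqb : q ∈ Metric.ball p r
          · have hqQ := hsubB hqb
            have h1 : UpperSemicontinuousWithinAt (fun x => max (uscEnv b u x) (ψ x)) (Q0set b) q := by
              refine UpperSemicontinuousWithinAt.sup (hUsub.1 q hq) ?_
              refine ContinuousWithinAt.upperSemicontinuousWithinAt ?_
              exact (hψcd.continuousOn.continuousAt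
                ((isOpen_Qset b).mem_nhds hqQ)).continuousWithinAt
            intro y hy
            have hy' : max (uscEnv b u q) (ψ q) < y := by simpa only [hw, if_pos hqb] using hy
            have := h1 y hy'
            filter_upwards [this, nhdsWithin_le_nhds (Metric.isOpen_ball.mem_nhds hqb)] with z h2 h3
            simpa only [hw, if_pos h3] using h2
          · intro y hy
            have hy' : uscEnv b u q < y := by simpa only [hw, if_neg hqb] using hy
            have := hUsub.1 q hq y hy'
            have hd : ∀ᶠ z in 𝓝 q, r / 2 < dist z p := by
              have : ContinuousAt (fun z => dist z p) q := by fun_prop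
              refine this.eventually_const_lt ?_
              rw [Metric.mem_ball, not_lt] at hqb
              linarith
            filter_upwards [this, nhdsWithin_le_nhds hd, self_mem_nhdsWithin] with z h2 h3 h4
            by_cases hz : z ∈ Metric.ball p r
            · have h5 := hannulus z (Metric.ball_subset_closedBall hz) h3.le
              have h6 := le_env hul h4
              simp only [hw, if_pos hz]
              rw [max_eq_left (h5.le.trans h6)]
              exact h2
            · simpa only [hw, if_neg hz] using h2
        · intro φ' hφ' q hq hmq
          have hqn := (isOpen_Qset b).mem_nhds hq
          by_cases hcase : w q = uscEnv b u q
          · refine hUsub.2 φ' hφ' q hq ?_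
            filter_upwards [hmq] with z hz
            have := hwu z
            linarith
          · have hqb : q ∈ Metric.ball p r := by
              by_contra hno
              exact hcase (by simp only [hw, if_neg hno])
            have hwq : w q = ψ q := by
              have h1 : w q = max (uscEnv b u q) (ψ q) := by simp only [hw, if_pos hqb]
              rcases max_choice (uscEnv b u q) (ψ q) with h2 | h2
              · exact absurd (h1.trans h2) hcase
              · exact h1.trans h2
            have hloc : IsLocalMax (fun z => ψ z - φ' z) q := by
              have hmq' := hmq.isLocalMax hqn
              filter_upwards [hmq', Metric.isOpen_ball.mem_nhds hqb] with z h1 h2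
              have := hwψ z h2
              linarith
            have h1 := Eop_mono (f := f) (g := g) hmono hg0 hφ' hψcd hq hloc
            have h2 := (hball (Metric.ball_subset_closedBall hqb)).1.1.1
            have h3 : Eop f g ψ q = Eop f g (fun z => φ z + bmp (-1) p z) q := Eop_add_const _ _ _
            change Eop f g φ' q ≤ 0
            linarith
        · intro φ1 hφ1 q hq
          have h1 := hUF.2 φ1 hφ1 q hq
          by_cases hqb : q ∈ Metric.ball p r
          · simp only [hw, if_pos hqb]
            refine max_le h1 ?_
            have h2 := hball (Metric.ball_subset_closedBall hqb)
            have h3 := h2.1.1.2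
            have h4 := h2.1.2.1
            have h5 : - φ1 q ≤ W q := (huuP φ1 hφ1 q hq).trans (le_env huul hq)
            simp only [hψ]
            linarith
          · simpa only [hw, if_neg hqb] using h1
      have e4 : ∀ᶠ q in 𝓝 p, φ p - δ / 2 < φ q + bmp (-1) p q :=
        hcont.eventually_const_lt (by simp only [bmp_self]; linarith)
      have e5 := freq_of_env hul.neg hp0 (c := - L p - δ / 2) (by
        have : L p = - uscEnv b (fun q => - u q) p := lscEnv_eq b u p
        linarith)
      rw [nhdsWithin_Q0 hp] at e5
      obtain ⟨q, h1, h2, h3⟩ := (e5.and_eventually (e4.and (Metric.ball_mem_nhds p hr))).exists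
      have h4 := huF w hwF q (Qset_sub b (hsubB h3))
      have h5 := hwψ q h3
      simp only [hψ] at h5
      linarith
  · intro t ht
    have hk : ∀ x ∈ Ioo (-b) b, ψ0 (x, t) ≤ L (x, t) := fun x hx =>
      cont_le_lscEnv hul (hSM ψ0 hψ0).2.1 (huF ψ0 (hSMF ψ0 hψ0)) ⟨hx, le_of_lt ht⟩
    obtain ⟨h1, h2⟩ := hψ0BC t ht
    refine ⟨tendsto_atTop_mono' _ ?_ h1, tendsto_atTop_mono' _ ?_ h2⟩
    · filter_upwards [Ioo_mem_nhdsLT (show -b < b by linarith)] with x hx using hk x hx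
    · filter_upwards [Ioo_mem_nhdsGT (show -b < b by linarith)] with x hx using hk x hx
  · intro x hx
    have hxq := hx0 x hx
    have h1 : uscEnv b u (x, 0) ≤ u0 x := by
      refine le_of_forall_pos_le_add fun η hη => ?_
      obtain ⟨φ, hφ, h⟩ := hP x hx η hη
      exact (hUF.2 φ hφ _ hxq).trans h
    have h2 : u0 x ≤ L (x, 0) := by
      refine le_of_forall_pos_le_add fun η hη => ?_
      obtain ⟨ψ, hψ, h⟩ := hM x hx η hη
      have := cont_le_lscEnv hul (hSM ψ hψ).2.1 (huF ψ (hSMF ψ hψ)) hxq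
      linarith
    have h3 : L (x, 0) ≤ u (x, 0) := lscEnv_le hul hxq
    have h4 := le_env hul hxq
    constructor <;> linarith

end perron

/-! ### The nonlinearities -/

/-- `f(s) = |s|^(β-1) s` -/
def fF (β : ℝ) : ℝ → ℝ := fun s => |s| ^ (β - 1) * s

/-- `g(s) = (p-1)|s|^(p-2) + ε` -/
def gG (p ε : ℝ) : ℝ → ℝ := fun s => (p - 1) * |s| ^ (p - 2) + ε

theorem fF_nonneg {β s : ℝ} (hβ : 0 < β) (hs : 0 ≤ s) : fF β s = s ^ β := by
  unfold fF
  rcases hs.eq_or_lt with h | h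
  · rw [← h, Real.zero_rpow hβ.ne', mul_zero]
  · rw [abs_of_pos h, Real.rpow_sub_one h.ne']
    field_simp

theorem fF_odd (β s : ℝ) : fF β (-s) = - fF β s := by
  unfold fF
  rw [abs_neg]
  ring

theorem fF_eq {β : ℝ} (hβ : 0 < β) (s : ℝ) : fF β s = max s 0 ^ β - max (-s) 0 ^ β := by
  rcases le_total 0 s with h | h
  · rw [max_eq_left h, max_eq_right (by linarith), Real.zero_rpow hβ.ne', sub_zero, fF_nonneg hβ h]
  · rw [max_eq_right h, max_eq_left (by linarith), Real.zero_rpow hβ.ne', zero_sub]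
    have := fF_odd β (-s)
    rw [neg_neg] at this
    rw [this, fF_nonneg hβ (by linarith)]

theorem fF_cont {β : ℝ} (hβ : 0 < β) : Continuous (fF β) := by
  have : fF β = fun s => max s 0 ^ β - max (-s) 0 ^ β := funext (fF_eq hβ)
  rw [this]
  exact ((continuous_id.max continuous_const).rpow_const fun _ => Or.inr hβ.le).sub
    ((continuous_neg.max continuous_const).rpow_const fun _ => Or.inr hβ.le)

theorem fF_mono {β : ℝ} (hβ : 0 < β) : Monotone (fF β) := by
  intro s t hst
  rw [fF_eq hβ, fF_eq hβ]
  have h1 : max s 0 ^ β ≤ max t 0 ^ β :=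
    Real.rpow_le_rpow (le_max_right _ _) (max_le_max_right 0 hst) hβ.le
  have h2 : max (-t) 0 ^ β ≤ max (-s) 0 ^ β :=
    Real.rpow_le_rpow (le_max_right _ _) (max_le_max_right 0 (by linarith)) hβ.le
  linarith

theorem gG_cont {p ε : ℝ} (hp : 2 ≤ p) : Continuous (gG p ε) := by
  unfold gG
  exact (continuous_const.mul (continuous_abs.rpow_const fun _ => Or.inr (by linarith))).add
    continuous_const

theorem gG_ge {p ε : ℝ} (hp : 2 ≤ p) (s : ℝ) : ε ≤ gG p ε s := by
  unfold gG
  have : 0 ≤ (p - 1) * |s| ^ (p - 2) := mul_nonneg (by linarith) (by positivity)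
  linarith

theorem gG_even (p ε s : ℝ) : gG p ε (-s) = gG p ε s := by
  unfold gG
  rw [abs_neg]

/-! ### Barriers -/

section barriers
variable {b : ℝ} {f g : ℝ → ℝ}

theorem sep_Eop {a a' k k1 k2 e e' : ℝ → ℝ} (ha : ∀ t, HasDerivAt a (a' t) t)
    (he : ∀ t, HasDerivAt e (e' t) t)
    (hk : ∀ x ∈ Ioo (-b) b, HasDerivAt k (k1 x) x)
    (hk1 : ∀ x ∈ Ioo (-b) b, HasDerivAt k1 (k2 x) x) {q : ℝ × ℝ} (hq : q ∈ Qset b) :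
    Eop f g (fun z => a z.2 * k z.1 + e z.2) q =
      a' q.2 * k q.1 + e' q.2 - f (g (a q.2 * k1 q.1) * (a q.2 * k2 q.1)) := by
  have hT : pT (fun z => a z.2 * k z.1 + e z.2) q = a' q.2 * k q.1 + e' q.2 :=
    (((ha q.2).mul_const (k q.1)).add (he q.2)).deriv
  have hX : ∀ z ∈ Qset b, pX (fun z => a z.2 * k z.1 + e z.2) z = a z.2 * k1 z.1 := fun z hz =>
    (((hk z.1 hz.1).const_mul (a z.2)).add_const (e z.2)).deriv
  have hXX : pXX (fun z => a z.2 * k z.1 + e z.2) q = a q.2 * k2 q.1 := by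
    rw [pXX_congr hq hX]
    exact ((hk1 q.1 hq.1).const_mul (a q.2)).deriv
  unfold Eop
  rw [hT, hX q hq, hXX]

theorem sep_cd {a k e : ℝ → ℝ} (ha : ContDiff ℝ 2 a) (he : ContDiff ℝ 2 e)
    (hk : ContDiffOn ℝ 2 k (Ioo (-b) b)) :
    ContDiffOn ℝ 2 (fun z : ℝ × ℝ => a z.2 * k z.1 + e z.2) (Qset b) ∧
    ContinuousOn (fun z : ℝ × ℝ => a z.2 * k z.1 + e z.2) (Q0set b) := by
  constructor
  · have h1 : ContDiffOn ℝ 2 (fun z : ℝ × ℝ => k z.1) (Qset b) :=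
      hk.comp contDiff_fst.contDiffOn (fun z hz => hz.1)
    exact ((ha.comp contDiff_snd).contDiffOn.mul h1).add (he.comp contDiff_snd).contDiffOn
  · have h1 : ContinuousOn (fun z : ℝ × ℝ => k z.1) (Q0set b) :=
      hk.continuousOn.comp continuous_fst.continuousOn (fun z hz => hz.1)
    exact ((ha.continuous.comp continuous_snd).continuousOn.mul h1).add
      (he.continuous.comp continuous_snd).continuousOn

theorem y_pos {x : ℝ} (hx : x ∈ Ioo (-b) b) : 0 < b ^ 2 - x ^ 2 := by
  nlinarith [hx.1, hx.2]

theorem H_deriv (γ : ℝ) {x : ℝ} (hx : x ∈ Ioo (-b) b) :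
    HasDerivAt (fun x => (b ^ 2 - x ^ 2) ^ (-γ)) (2 * γ * x * (b ^ 2 - x ^ 2) ^ (-(γ + 1))) x := by
  have h1 : HasDerivAt (fun x : ℝ => b ^ 2 - x ^ 2) (-(2 * x)) x := by
    have := ((hasDerivAt_id x).pow 2).const_sub (b ^ 2)
    simpa using this
  have h2 := h1.rpow_const (p := -γ) (Or.inl (y_pos hx).ne')
  convert h2 using 1
  rw [show -γ - 1 = -(γ + 1) by ring]
  ring

theorem H_cd (γ : ℝ) : ContDiffOn ℝ 2 (fun x => (b ^ 2 - x ^ 2) ^ (-γ)) (Ioo (-b) b) := by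
  refine ContDiffOn.rpow_const_of_ne ?_ fun x hx => (y_pos hx).ne'
  fun_prop

theorem y_split {y : ℝ} (hy : 0 < y) (γ : ℝ) : y ^ (-γ) = y * y ^ (-(γ + 1)) := by
  rw [show -γ = 1 + -(γ + 1) by ring, Real.rpow_add hy, Real.rpow_one]

/-- quadratic lower barriers -/
theorem lower_quad (hf : Continuous f) (hg : Continuous g) (c A ξ : ℝ) : ∃ K : ℝ, 0 ≤ K ∧
    ContDiffOn ℝ 2 (fun z : ℝ × ℝ => 1 * (-A * (z.1 - ξ) ^ 2) + (c - K * z.2)) (Qset b) ∧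
    ContinuousOn (fun z : ℝ × ℝ => 1 * (-A * (z.1 - ξ) ^ 2) + (c - K * z.2)) (Q0set b) ∧
    ∀ q ∈ Qset b, Eop f g (fun z : ℝ × ℝ => 1 * (-A * (z.1 - ξ) ^ 2) + (c - K * z.2)) q ≤ 0 := by
  have hcont : Continuous (fun x => f (g (1 * (-A * (2 * (x - ξ)))) * (1 * (-A * 2)))) := by
    fun_prop
  obtain ⟨K, hK⟩ := (isCompact_Icc (a := -b) (b := b)).exists_bound_of_continuousOn hcont.continuousOn
  refine ⟨max K 0, le_max_right _ _, ?_⟩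
  have hcd := sep_cd (b := b) (a := fun _ => 1) (k := fun x => -A * (x - ξ) ^ 2)
    (e := fun t => c - max K 0 * t) (by fun_prop) (by fun_prop) (by fun_prop)
  refine ⟨hcd.1, hcd.2, fun q hq => ?_⟩
  rw [sep_Eop (a := fun _ => 1) (a' := fun _ => 0) (k := fun x => -A * (x - ξ) ^ 2)
    (e := fun t => c - max K 0 * t) (e' := fun _ => -max K 0)
    (k1 := fun x => -A * (2 * (x - ξ))) (k2 := fun x => -A * 2) ?_ ?_ ?_ ?_ hq]
  · have h1 := hK q.1 ⟨hq.1.1.le, hq.1.2.le⟩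
    rw [Real.norm_eq_abs, abs_le] at h1
    have := le_max_left K 0
    linarith [h1.1]
  · intro t
    exact hasDerivAt_const _ _
  · intro t
    have := ((hasDerivAt_id t).const_mul (max K 0)).const_sub c
    simpa using this
  · intro x _
    have := (((hasDerivAt_id x).sub_const ξ).pow 2).const_mul (-A)
    simpa using this
  · intro x _
    have := (((hasDerivAt_id x).sub_const ξ).const_mul 2).const_mul (-A)
    simpa using this

theorem exists_kappa {β D D' : ℝ} (hβ1 : β < 1) (hD : 0 < D) (hD' : 0 < D') :
    ∃ κ : ℝ, 0 < κ ∧ κ * D ≤ κ ^ β * D' := by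
  have h1 : 0 < 1 - β := by linarith
  have hq : 0 < D' / D := by positivity
  refine ⟨(D' / D) ^ (1 / (1 - β)), by positivity, ?_⟩
  set κ := (D' / D) ^ (1 / (1 - β)) with hκ
  have hκ0 : 0 < κ := by positivity
  have h2 : κ ^ (1 - β) = D' / D := by
    rw [hκ, ← Real.rpow_mul hq.le, one_div_mul_cancel h1.ne', Real.rpow_one]
  have h3 : κ = κ ^ β * κ ^ (1 - β) := by
    rw [← Real.rpow_add hκ0]
    simp
  have h4 : κ * D = κ ^ β * (D' / D) * D := by rw [← h2, ← h3]
  rw [h4]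
  apply le_of_eq
  field_simp

/-- lower barrier which is infinite on the lateral boundary for positive times -/
theorem lower_blow (hb : 0 < b) {β ε : ℝ} (hβ : 0 < β) (hβ1 : β < 1) (hε : 0 < ε)
    (hgε : ∀ s, ε ≤ g s) : ∃ w : ℝ × ℝ → ℝ,
    ContDiffOn ℝ 2 w (Qset b) ∧ ContinuousOn w (Q0set b) ∧ (∀ q ∈ Qset b, Eop (fF β) g w q ≤ 0) ∧
    (∀ t : ℝ, 0 < t → SingularBC b w t) ∧
    ∃ D : ℝ, 0 < D ∧ ∀ q ∈ Q0set b, w q ≤ D * (Real.exp q.2 - 1) * (b ^ 2 - q.1 ^ 2) ^ (-β) := by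
  have h1β : 0 < 1 - β := by linarith
  obtain ⟨n, hn⟩ := exists_nat_ge (1 / (1 - β))
  have hn1 : 1 ≤ (n : ℝ) * (1 - β) := by
    rwa [div_le_iff₀ h1β] at hn
  have hnpos : 0 < (n : ℝ) := lt_of_lt_of_le (by positivity) hn
  have hn0 : 1 ≤ n := by exact_mod_cast Nat.pos_of_ne_zero (fun h => by simp [h] at hnpos)
  set c1 := ε * (2 * β * b ^ 2) with hc1
  have hc1p : 0 < c1 := by positivity
  set e := -β + (β + 2) * β with he
  have he0 : 0 ≤ e := by rw [he]; nlinarith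
  obtain ⟨κ, hκ, hκle⟩ := exists_kappa (D := n * (b ^ 2) ^ e) (D' := c1 ^ β) hβ1
    (by positivity) (by positivity)
  set θ : ℝ → ℝ := fun t => κ * (1 - Real.exp (-t)) ^ n with hθ
  set θ' : ℝ → ℝ := fun t => κ * (n * (1 - Real.exp (-t)) ^ (n - 1) * Real.exp (-t)) with hθ'
  set k : ℝ → ℝ := fun x => (b ^ 2 - x ^ 2) ^ (-β) with hk
  have hcd := sep_cd (b := b) (a := θ) (k := k) (e := fun _ => 0)
    (by rw [hθ]; fun_prop) (by fun_prop) (H_cd β)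
  refine ⟨fun z => θ z.2 * k z.1 + 0, hcd.1, hcd.2, ?_, ?_, κ, hκ, ?_⟩
  · intro q hq
    have hx := hq.1
    have ht : 0 < q.2 := hq.2
    have hy := y_pos hx
    rw [sep_Eop (a := θ) (a' := θ') (k := k) (e := fun _ => 0) (e' := fun _ => 0)
      (k1 := fun x => 2 * β * x * (b ^ 2 - x ^ 2) ^ (-(β + 1)))
      (k2 := fun x => 2 * β * (b ^ 2 - x ^ 2) ^ (-(β + 1)) +
        2 * β * x * (2 * (β + 1) * x * (b ^ 2 - x ^ 2) ^ (-(β + 1 + 1)))) ?_ ?_ ?_ ?_ hq]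
    · have hE0 : 0 < 1 - Real.exp (-q.2) := by
        have : Real.exp (-q.2) < 1 := Real.exp_lt_one_iff.2 (by linarith)
        linarith
      have hE1 : 1 - Real.exp (-q.2) ≤ 1 := by
        have := Real.exp_pos (-q.2)
        linarith
      have hexp1 : Real.exp (-q.2) ≤ 1 := (Real.exp_lt_one_iff.2 (by linarith)).le
      set E := 1 - Real.exp (-q.2) with hE
      set y := b ^ 2 - q.1 ^ 2 with hyd
      set z := y ^ (-(β + 1 + 1)) with hz
      have hz0 : 0 < z := by positivity
      have hk2 : 2 * β * b ^ 2 * z ≤ 2 * β * y ^ (-(β + 1)) +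
          2 * β * q.1 * (2 * (β + 1) * q.1 * z) := by
        rw [y_split hy (β + 1), ← hz]
        have : 2 * β * (y * z) + 2 * β * q.1 * (2 * (β + 1) * q.1 * z) - 2 * β * b ^ 2 * z
          = 2 * β * z * (q.1 ^ 2 * (2 * β + 1)) := by
          rw [hyd]; ring
        have h2 : 0 ≤ 2 * β * z * (q.1 ^ 2 * (2 * β + 1)) := by positivity
        linarith
      have hθv : θ q.2 = κ * E ^ n := rfl
      have hθ'v : θ' q.2 = κ * (n * E ^ (n - 1) * Real.exp (-q.2)) := rfl
      have hkv : k q.1 = y ^ (-β) := rfl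
      have hY : κ * c1 * E ^ n * z ≤ g (θ q.2 * (2 * β * q.1 * y ^ (-(β + 1)))) *
          (θ q.2 * (2 * β * y ^ (-(β + 1)) + 2 * β * q.1 * (2 * (β + 1) * q.1 * z))) := by
        rw [hθv]
        have h3 : κ * E ^ n * (2 * β * b ^ 2 * z) ≤ κ * E ^ n * (2 * β * y ^ (-(β + 1)) +
          2 * β * q.1 * (2 * (β + 1) * q.1 * z)) := mul_le_mul_of_nonneg_left hk2 (by positivity)
        have h4 := mul_le_mul (hgε (κ * E ^ n * (2 * β * q.1 * y ^ (-(β + 1))))) h3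
          (by positivity) (hε.le.trans (hgε _))
        refine le_trans (le_of_eq ?_) h4
        rw [hc1]; ring
      have hfY := fF_mono hβ hY
      rw [fF_nonneg hβ (by positivity)] at hfY
      have hpow : (κ * c1 * E ^ n * z) ^ β = κ ^ β * c1 ^ β * (E ^ n) ^ β * z ^ β := by
        rw [Real.mul_rpow (by positivity) hz0.le, Real.mul_rpow (by positivity) (by positivity),
          Real.mul_rpow hκ.le hc1p.le]
      have hEpow : E ^ (n - 1) ≤ (E ^ n) ^ β := by
        rw [← Real.rpow_natCast, ← Real.rpow_natCast, ← Real.rpow_mul hE0.le]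
        refine Real.rpow_le_rpow_of_exponent_ge hE0 hE1 ?_
        rw [Nat.cast_sub hn0]
        push_cast
        linarith
      have hyb : y ≤ b ^ 2 := by rw [hyd]; nlinarith [sq_nonneg q.1]
      have hyβ : y ^ (-β) ≤ z ^ β * (b ^ 2) ^ e := by
        have : y ^ (-β) = z ^ β * y ^ e := by
          rw [hz, ← Real.rpow_mul hy.le, ← Real.rpow_add hy]
          congr 1
          rw [he]; ring
        rw [this]
        exact mul_le_mul_of_nonneg_left (Real.rpow_le_rpow hy.le hyb he0) (by positivity)
      have hfin : θ' q.2 * k q.1 ≤ (κ * c1 * E ^ n * z) ^ β := by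
        rw [hθ'v, hkv, hpow]
        calc κ * (n * E ^ (n - 1) * Real.exp (-q.2)) * y ^ (-β)
            ≤ κ * (n * E ^ (n - 1) * 1) * (z ^ β * (b ^ 2) ^ e) := by gcongr
          _ = (κ * (n * (b ^ 2) ^ e)) * (E ^ (n - 1) * z ^ β) := by ring
          _ ≤ (κ ^ β * c1 ^ β) * ((E ^ n) ^ β * z ^ β) := by gcongr
          _ = κ ^ β * c1 ^ β * (E ^ n) ^ β * z ^ β := by ring
      linarith
    · intro t
      have h1 : HasDerivAt (fun t : ℝ => 1 - Real.exp (-t)) (Real.exp (-t)) t := by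
        have := ((hasDerivAt_neg t).exp).const_sub 1
        simpa using this
      exact (h1.pow n).const_mul κ
    · intro t
      exact hasDerivAt_const _ _
    · intro x hx
      exact H_deriv β hx
    · intro x hx
      have h1 : HasDerivAt (fun x : ℝ => 2 * β * x) (2 * β) x := by
        simpa using (hasDerivAt_id x).const_mul (2 * β)
      exact h1.mul (H_deriv (β + 1) hx)
  · intro t ht
    have hE0 : 0 < 1 - Real.exp (-t) := by
      have : Real.exp (-t) < 1 := Real.exp_lt_one_iff.2 (by linarith)
      linarith
    have hθp : 0 < θ t := by rw [hθ]; positivity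
    have key : ∀ l : Filter ℝ, (∀ᶠ x in l, x ∈ Ioo (-b) b) →
        Tendsto (fun x : ℝ => b ^ 2 - x ^ 2) l (𝓝 0) →
        Tendsto (fun x => θ t * k x + 0) l atTop := by
      intro l hl hl0
      have h1 : Tendsto (fun x : ℝ => b ^ 2 - x ^ 2) l (𝓝[>] 0) :=
        tendsto_nhdsWithin_iff.2 ⟨hl0, hl.mono fun x hx => y_pos hx⟩
      have h2 := (tendsto_rpow_neg_nhdsGT_zero (y := -β) (by linarith)).comp h1
      simp only [add_zero]
      exact h2.const_mul_atTop hθp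
    have hc : Continuous (fun x : ℝ => b ^ 2 - x ^ 2) := by fun_prop
    constructor
    · refine key _ (Ioo_mem_nhdsLT (by linarith)) ?_
      have := hc.tendsto b
      simp only [sub_self] at this
      exact this.mono_left nhdsWithin_le_nhds
    · refine key _ (Ioo_mem_nhdsGT (by linarith)) ?_
      have := hc.tendsto (-b)
      simp only [even_two, Even.neg_pow, sub_self] at this
      exact this.mono_left nhdsWithin_le_nhds
  · intro q hq
    have hy := y_pos hq.1
    have ht : 0 ≤ q.2 := hq.2
    have h1 := Real.add_one_le_exp (-q.2)
    have h2 := Real.add_one_le_exp q.2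
    have h3 : Real.exp (-q.2) ≤ 1 := Real.exp_le_one_iff.2 (by linarith)
    have h4 := Real.exp_pos (-q.2)
    have h5 : (1 - Real.exp (-q.2)) ^ n ≤ Real.exp q.2 - 1 :=
      (pow_le_of_le_one (by linarith) (by linarith) (by omega)).trans (by linarith)
    simp only [add_zero, hθ, hk]
    gcongr

end barriers

section upper
variable {b : ℝ}

set_option maxHeartbeats 4000000 in
/-- upper barriers -/
theorem upper_barrier (hb : 0 < b) {p ε β γ ξ : ℝ} (hp : 2 ≤ p) (hε : 0 < ε) (hβ : 0 < β)
    (hβp : β * (p - 1) ≤ 1) (hγ : 0 < γ) (hγβ : (γ * (p - 1) + p) * β ≤ γ) (hξ : ξ ∈ Ioo (-b) b) :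
    ∃ l c : ℝ, 1 ≤ l ∧ 0 < c ∧
    (∀ x ∈ Ioo (-b) b, c * (b ^ 2 - x ^ 2) ^ (-γ) ≤ (x - ξ) ^ 2 * (b ^ 2 - x ^ 2) ^ (-γ) + 1) ∧
    ∀ A e : ℝ, 1 ≤ A → 
      ContDiffOn ℝ 2 (fun z : ℝ × ℝ => A * Real.exp (l * z.2) *
        ((z.1 - ξ) ^ 2 * (b ^ 2 - z.1 ^ 2) ^ (-γ) + 1) + e) (Qset b) ∧
      ContinuousOn (fun z : ℝ × ℝ => A * Real.exp (l * z.2) *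
        ((z.1 - ξ) ^ 2 * (b ^ 2 - z.1 ^ 2) ^ (-γ) + 1) + e) (Q0set b) ∧
      ∀ q ∈ Qset b, 0 ≤ Eop (fF β) (gG p ε) (fun z : ℝ × ℝ => A * Real.exp (l * z.2) *
        ((z.1 - ξ) ^ 2 * (b ^ 2 - z.1 ^ 2) ^ (-γ) + 1) + e) q := by
  -- the constant `c`
  have hcontm : Continuous (fun x : ℝ => (b ^ 2 - x ^ 2) ^ γ + (x - ξ) ^ 2) :=
    ((by fun_prop : Continuous (fun x : ℝ => b ^ 2 - x ^ 2)).rpow_const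
      fun _ => Or.inr hγ.le).add (by fun_prop)
  obtain ⟨x0, hx0, hmin⟩ := (isCompact_Icc (a := -b) (b := b)).exists_isMinOn
    ⟨ξ, hξ.1.le, hξ.2.le⟩ hcontm.continuousOn
  set c := (b ^ 2 - x0 ^ 2) ^ γ + (x0 - ξ) ^ 2 with hc
  have hc0 : 0 < c := by
    have hy0 : 0 ≤ b ^ 2 - x0 ^ 2 := by nlinarith [hx0.1, hx0.2]
    rcases hy0.eq_or_lt with h | h
    · have hne : x0 - ξ ≠ 0 := by
        intro h0
        have : x0 = ξ := by linarith
        have := y_pos hξ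
        rw [← ‹x0 = ξ›] at this
        linarith
      have h1 : 0 ≤ (b ^ 2 - x0 ^ 2) ^ γ := by positivity
      have h2 : 0 < (x0 - ξ) ^ 2 := by positivity
      linarith
    · have h1 : 0 < (b ^ 2 - x0 ^ 2) ^ γ := by positivity
      have h2 : 0 ≤ (x0 - ξ) ^ 2 := by positivity
      linarith
  have hclow : ∀ x ∈ Ioo (-b) b,
      c * (b ^ 2 - x ^ 2) ^ (-γ) ≤ (x - ξ) ^ 2 * (b ^ 2 - x ^ 2) ^ (-γ) + 1 := by
    intro x hx
    have hy := y_pos hx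
    have h1 : c ≤ (b ^ 2 - x ^ 2) ^ γ + (x - ξ) ^ 2 := hmin ⟨hx.1.le, hx.2.le⟩
    have h2 : (b ^ 2 - x ^ 2) ^ γ * (b ^ 2 - x ^ 2) ^ (-γ) = 1 := by
      rw [← Real.rpow_add hy]; simp
    have h3 : 0 < (b ^ 2 - x ^ 2) ^ (-γ) := by positivity
    nlinarith
  -- bounds for the derivatives
  obtain ⟨C0, hC0⟩ := (isCompact_Icc (a := -b) (b := b)).exists_bound_of_continuousOn
    (f := fun x : ℝ => 2 * (x - ξ) * (b ^ 2 - x ^ 2) + (x - ξ) ^ 2 * (2 * γ * x)) (by fun_prop)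
  obtain ⟨C1, hC1⟩ := (isCompact_Icc (a := -b) (b := b)).exists_bound_of_continuousOn
    (f := fun x : ℝ => 2 * (b ^ 2 - x ^ 2) ^ 2 + 2 * (x - ξ) * (2 * γ * x) * (b ^ 2 - x ^ 2) +
      (2 * (x - ξ) * (2 * γ * x) * (b ^ 2 - x ^ 2) + (x - ξ) ^ 2 *
        (2 * γ * (b ^ 2 - x ^ 2) + 2 * γ * x * (2 * (γ + 1) * x)))) (by fun_prop)
  set C := max 1 (max C0 C1) with hC
  have hCp : 0 < C := lt_of_lt_of_le one_pos (le_max_left _ _)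
  have hC0C : C0 ≤ C := (le_max_left _ _).trans (le_max_right _ _)
  have hC1C : C1 ≤ C := (le_max_right _ _).trans (le_max_right _ _)
  set G := (p - 1) * C ^ (p - 2) + ε * ((b ^ 2) ^ (γ + 1)) ^ (p - 2) with hG
  have hp1 : 0 < p - 1 := by linarith
  have hGp : 0 < G := by positivity
  set m := γ * (p - 1) + p with hm
  set l := max 1 ((G * C) ^ β * (b ^ 2) ^ (γ - m * β) / c) with hl
  have hl1 : 1 ≤ l := le_max_left _ _
  have hlc : (G * C) ^ β * (b ^ 2) ^ (γ - m * β) ≤ l * c := by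
    rw [← div_le_iff₀ hc0]
    exact le_max_right _ _
  refine ⟨l, c, hl1, hc0, hclow, fun A e hA => ?_⟩
  have hkcd : ContDiffOn ℝ 2 (fun x : ℝ => (x - ξ) ^ 2 * (b ^ 2 - x ^ 2) ^ (-γ) + 1) (Ioo (-b) b) := by
    refine ContDiffOn.add (ContDiffOn.mul ?_ (H_cd γ)) contDiffOn_const
    fun_prop
  have hcd := sep_cd (b := b) (a := fun t => A * Real.exp (l * t)) (e := fun _ => e)
    (by fun_prop) (by fun_prop) hkcd
  refine ⟨hcd.1, hcd.2, fun q hq => ?_⟩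
  rw [sep_Eop (a := fun t => A * Real.exp (l * t)) (a' := fun t => A * (Real.exp (l * t) * l))
    (k := fun x => (x - ξ) ^ 2 * (b ^ 2 - x ^ 2) ^ (-γ) + 1) (e := fun _ => e) (e' := fun _ => 0)
    (k1 := fun x => 2 * (x - ξ) * (b ^ 2 - x ^ 2) ^ (-γ) +
      (x - ξ) ^ 2 * (2 * γ * x * (b ^ 2 - x ^ 2) ^ (-(γ + 1))))
    (k2 := fun x => 2 * (b ^ 2 - x ^ 2) ^ (-γ) +
        2 * (x - ξ) * (2 * γ * x * (b ^ 2 - x ^ 2) ^ (-(γ + 1))) +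
      (2 * (x - ξ) * (2 * γ * x * (b ^ 2 - x ^ 2) ^ (-(γ + 1))) +
      (x - ξ) ^ 2 * (2 * γ * (b ^ 2 - x ^ 2) ^ (-(γ + 1)) +
        2 * γ * x * (2 * (γ + 1) * x * (b ^ 2 - x ^ 2) ^ (-(γ + 1 + 1)))))) ?_ ?_ ?_ ?_ hq]
  · have hx := hq.1
    have ht : 0 < q.2 := hq.2
    have hy := y_pos hx
    have hxI : q.1 ∈ Icc (-b) b := ⟨hx.1.le, hx.2.le⟩
    have hlow := hclow q.1 hx
    have hP := (hC0 q.1 hxI).trans hC0C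
    have hR := (hC1 q.1 hxI).trans hC1C
    rw [Real.norm_eq_abs] at hP hR
    set B := A * Real.exp (l * q.2) with hB
    have hB1 : 1 ≤ B := by
      have : 1 ≤ Real.exp (l * q.2) := Real.one_le_exp (by positivity)
      rw [hB]; nlinarith
    have hB0 : 0 < B := by linarith
    set y := b ^ 2 - q.1 ^ 2 with hyd
    have hyb : y ≤ b ^ 2 := by rw [hyd]; nlinarith [sq_nonneg q.1]
    set h := (q.1 - ξ) ^ 2 * y ^ (-γ) + 1 with hh
    set k1 := 2 * (q.1 - ξ) * y ^ (-γ) + (q.1 - ξ) ^ 2 * (2 * γ * q.1 * y ^ (-(γ + 1))) with hk1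
    set k2 := 2 * y ^ (-γ) + 2 * (q.1 - ξ) * (2 * γ * q.1 * y ^ (-(γ + 1))) +
      (2 * (q.1 - ξ) * (2 * γ * q.1 * y ^ (-(γ + 1))) +
      (q.1 - ξ) ^ 2 * (2 * γ * y ^ (-(γ + 1)) +
        2 * γ * q.1 * (2 * (γ + 1) * q.1 * y ^ (-(γ + 1 + 1))))) with hk2
    set z := y ^ (-(γ + 1)) with hz
    set z2 := y ^ (-(γ + 1 + 1)) with hz2
    have hz0 : 0 < z := by positivity
    have hz20 : 0 < z2 := by positivity
    have e1 : y ^ (-γ) = y * z := y_split hy γ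
    have e2 : z = y * z2 := y_split hy (γ + 1)
    have b1 : |k1| ≤ C * z := by
      have : k1 = (2 * (q.1 - ξ) * y + (q.1 - ξ) ^ 2 * (2 * γ * q.1)) * z := by
        rw [hk1, e1]; ring
      rw [this, abs_mul, abs_of_pos hz0]
      exact mul_le_mul_of_nonneg_right hP hz0.le
    have b2 : |k2| ≤ C * z2 := by
      have : k2 = (2 * y ^ 2 + 2 * (q.1 - ξ) * (2 * γ * q.1) * y +
          (2 * (q.1 - ξ) * (2 * γ * q.1) * y + (q.1 - ξ) ^ 2 *
          (2 * γ * y + 2 * γ * q.1 * (2 * (γ + 1) * q.1)))) * z2 := by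
        rw [hk2, e1, e2]; ring
      rw [this, abs_mul, abs_of_pos hz20]
      exact mul_le_mul_of_nonneg_right hR hz20.le
    have hp2 : 0 ≤ p - 2 := by linarith
    have bg : gG p ε (B * k1) ≤ G * (B * z) ^ (p - 2) := by
      unfold gG
      have h1 : |B * k1| ^ (p - 2) ≤ C ^ (p - 2) * (B * z) ^ (p - 2) := by
        rw [← Real.mul_rpow hCp.le (by positivity)]
        refine Real.rpow_le_rpow (abs_nonneg _) ?_ hp2
        rw [abs_mul, abs_of_pos hB0]
        calc B * |k1| ≤ B * (C * z) := by gcongr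
          _ = C * (B * z) := by ring
      have h2 : 1 ≤ ((b ^ 2) ^ (γ + 1)) ^ (p - 2) * (B * z) ^ (p - 2) := by
        rw [← Real.mul_rpow (by positivity) (by positivity)]
        refine Real.one_le_rpow ?_ hp2
        have h3 : 1 = y ^ (γ + 1) * z := by
          rw [hz, ← Real.rpow_add hy]; simp
        have h4 : y ^ (γ + 1) ≤ (b ^ 2) ^ (γ + 1) := Real.rpow_le_rpow hy.le hyb (by linarith)
        have h5 : y ^ (γ + 1) * z ≤ (b ^ 2) ^ (γ + 1) * z := by gcongr
        have h6 : (b ^ 2) ^ (γ + 1) * z ≤ (b ^ 2) ^ (γ + 1) * (B * z) := by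
          gcongr
          nlinarith
        linarith
      rw [hG]
      have h3 := mul_le_mul_of_nonneg_left h1 hp1.le
      have h4 := mul_le_mul_of_nonneg_left h2 hε.le
      calc (p - 1) * |B * k1| ^ (p - 2) + ε 
          ≤ (p - 1) * (C ^ (p - 2) * (B * z) ^ (p - 2)) +
            ε * (((b ^ 2) ^ (γ + 1)) ^ (p - 2) * (B * z) ^ (p - 2)) := by linarith
        _ = _ := by ring
    have bY : gG p ε (B * k1) * (B * k2) ≤ (G * C) * (B ^ (p - 1) * y ^ (-m)) := by
      have h1 : B * k2 ≤ B * (C * z2) := mul_le_mul_of_nonneg_left ((le_abs_self _).trans b2) hB0.le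
      have h0 : 0 ≤ gG p ε (B * k1) := hε.le.trans (gG_ge hp _)
      have h2 : (B * z) ^ (p - 2) * (B * z2) = B ^ (p - 1) * y ^ (-m) := by
        have a1 : B ^ (p - 1) = B ^ (p - 2) * B := by
          rw [show p - 1 = (p - 2) + 1 by ring, Real.rpow_add hB0, Real.rpow_one]
        have a2 : y ^ (-m) = z ^ (p - 2) * z2 := by
          rw [hz, hz2, ← Real.rpow_mul hy.le, ← Real.rpow_add hy]
          congr 1
          rw [hm]; ring
        rw [Real.mul_rpow hB0.le hz0.le, a1, a2]; ring
      calc gG p ε (B * k1) * (B * k2) ≤ gG p ε (B * k1) * (B * (C * z2)) :=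
            mul_le_mul_of_nonneg_left h1 h0
        _ ≤ G * (B * z) ^ (p - 2) * (B * (C * z2)) :=
            mul_le_mul_of_nonneg_right bg (by positivity)
        _ = (G * C) * ((B * z) ^ (p - 2) * (B * z2)) := by ring
        _ = _ := by rw [h2]
    have bf := fF_mono hβ bY
    have hpos : 0 ≤ (G * C) * (B ^ (p - 1) * y ^ (-m)) := by positivity
    rw [fF_nonneg hβ hpos] at bf
    have bpow : ((G * C) * (B ^ (p - 1) * y ^ (-m))) ^ β ≤ l * B * h := by
      rw [Real.mul_rpow (x := G * C) (y := B ^ (p - 1) * y ^ (-m)) (by positivity)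
        (by positivity), Real.mul_rpow (x := B ^ (p - 1)) (y := y ^ (-m)) (by positivity)
        (by positivity), ← Real.rpow_mul hB0.le,
        ← Real.rpow_mul hy.le]
      have h1 : B ^ ((p - 1) * β) ≤ B := by
        have := Real.rpow_le_rpow_of_exponent_le hB1 (show (p - 1) * β ≤ 1 by linarith)
        rwa [Real.rpow_one] at this
      have h2 : y ^ (-m * β) ≤ (b ^ 2) ^ (γ - m * β) * y ^ (-γ) := by
        have : y ^ (-m * β) = y ^ (γ - m * β) * y ^ (-γ) := by
          rw [← Real.rpow_add hy]
          congr 1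
          ring
        rw [this]
        have h3 : y ^ (γ - m * β) ≤ (b ^ 2) ^ (γ - m * β) :=
          Real.rpow_le_rpow hy.le hyb (by linarith)
        gcongr
      calc (G * C) ^ β * (B ^ ((p - 1) * β) * y ^ (-m * β))
          ≤ (G * C) ^ β * (B * ((b ^ 2) ^ (γ - m * β) * y ^ (-γ))) := by gcongr
        _ = ((G * C) ^ β * (b ^ 2) ^ (γ - m * β)) * (B * y ^ (-γ)) := by ring
        _ ≤ (l * c) * (B * y ^ (-γ)) := by gcongr
        _ = l * B * (c * y ^ (-γ)) := by ring
        _ ≤ l * B * h := by gcongr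
    have : A * (Real.exp (l * q.2) * l) * h = l * B * h := by rw [hB]; ring
    linarith
  · intro t
    have h1 : HasDerivAt (fun t : ℝ => l * t) l t := by
      simpa using (hasDerivAt_id t).const_mul l
    exact h1.exp.const_mul A
  · intro t
    exact hasDerivAt_const _ _
  · intro x hx
    have h1 : HasDerivAt (fun x : ℝ => (x - ξ) ^ 2) (2 * (x - ξ)) x := by
      have := (((hasDerivAt_id x).sub_const ξ).fun_pow 2)
      simpa using this
    exact (h1.mul (H_deriv γ hx)).add_const 1
  · intro x hx
    have h1 : HasDerivAt (fun x : ℝ => (x - ξ) ^ 2) (2 * (x - ξ)) x := by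
      have := (((hasDerivAt_id x).sub_const ξ).fun_pow 2)
      simpa using this
    have h2 : HasDerivAt (fun x : ℝ => 2 * (x - ξ)) 2 x := by
      simpa using ((hasDerivAt_id x).sub_const ξ).const_mul 2
    have h3 : HasDerivAt (fun x : ℝ => 2 * γ * x) (2 * γ) x := by
      simpa using (hasDerivAt_id x).const_mul (2 * γ)
    exact (h2.mul (H_deriv γ hx)).add (h1.mul (h3.mul (H_deriv (γ + 1) hx)))

/-! ### Initial data -/

theorem bdd_of_ends (hb : 0 < b) {F : ℝ → ℝ} (hF : ContinuousOn F (Ioo (-b) b))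
    (h1 : ∃ C, ∀ᶠ x in 𝓝[<] b, F x ≤ C) (h2 : ∃ C, ∀ᶠ x in 𝓝[>] (-b), F x ≤ C) :
    ∃ C, ∀ x ∈ Ioo (-b) b, F x ≤ C := by
  obtain ⟨C1, h1⟩ := h1
  obtain ⟨C2, h2⟩ := h2
  obtain ⟨r, hr, h1⟩ := (mem_nhdsLT_iff_exists_Ioo_subset' (show -b < b by linarith)).1 h1
  obtain ⟨s, hs, h2⟩ := (mem_nhdsGT_iff_exists_Ioo_subset' (show -b < b by linarith)).1 h2
  have hrb : r < b := hr
  have hsb : -b < s := hs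
  by_cases hrs : s ≤ r
  · obtain ⟨C3, h3⟩ := (isCompact_Icc (a := s) (b := r)).exists_bound_of_continuousOn
      (hF.mono fun x hx => ⟨by linarith [hx.1], by linarith [hx.2]⟩)
    refine ⟨max C1 (max C2 C3), fun x hx => ?_⟩
    rcases lt_or_ge r x with h | h
    · exact (h1 ⟨h, hx.2⟩ : F x ≤ C1).trans (le_max_left _ _)
    · rcases lt_or_ge x s with h' | h'
      · exact (h2 ⟨hx.1, h'⟩ : F x ≤ C2).trans ((le_max_left _ _).trans (le_max_right _ _))
      · exact ((le_abs_self _).trans (h3 x ⟨h', h⟩)).trans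
          ((le_max_right _ _).trans (le_max_right _ _))
  · push Not at hrs
    refine ⟨max C1 C2, fun x hx => ?_⟩
    rcases lt_or_ge r x with h | h
    · exact (h1 ⟨h, hx.2⟩ : F x ≤ C1).trans (le_max_left _ _)
    · exact (h2 ⟨hx.1, by linarith⟩ : F x ≤ C2).trans (le_max_right _ _)

theorem end_bound {v s r γ0 γ C d : ℝ} (hs : 0 < s) (hr : 0 < r) (hsd : s ≤ d) (hrd : r ≤ d)
    (hγ0 : 0 < γ0) (hγ : γ0 ≤ γ) (h : v * s ^ γ0 ≤ C) :
    v * (s * r) ^ γ ≤ |C| * (d ^ (γ - γ0) * d ^ γ) := by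
  have e : v * (s * r) ^ γ = v * s ^ γ0 * (s ^ (γ - γ0) * r ^ γ) := by
    rw [Real.mul_rpow hs.le hr.le, show s ^ γ = s ^ γ0 * s ^ (γ - γ0) by
      rw [← Real.rpow_add hs]; congr 1; ring]
    ring
  rw [e]
  have h1 : s ^ (γ - γ0) ≤ d ^ (γ - γ0) := Real.rpow_le_rpow hs.le hsd (by linarith)
  have h2 : r ^ γ ≤ d ^ γ := Real.rpow_le_rpow hr.le hrd (by linarith)
  have h3 : 0 < s ^ (γ - γ0) := by positivity
  have h4 : 0 < r ^ γ := by positivity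
  have hd : 0 < d := by linarith
  have h5 : 0 ≤ d ^ (γ - γ0) := by positivity
  calc v * s ^ γ0 * (s ^ (γ - γ0) * r ^ γ) ≤ |C| * (s ^ (γ - γ0) * r ^ γ) := by
        gcongr
        exact h.trans (le_abs_self C)
    _ ≤ _ := by gcongr

theorem init_facts (hb : 0 < b) {u0 : ℝ → ℝ} (h : B1 b u0 ∨ B2 b u0) :
    ContinuousOn u0 (Ioo (-b) b) ∧ (∃ M, ∀ x ∈ Ioo (-b) b, -M ≤ u0 x) ∧
    ∃ γ0 : ℝ, ∀ γ : ℝ, γ0 ≤ γ → ∃ C : ℝ, ∀ x ∈ Ioo (-b) b, u0 x * (b ^ 2 - x ^ 2) ^ γ ≤ C := by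
  have hycont : ∀ γ : ℝ, ContinuousOn (fun x : ℝ => (b ^ 2 - x ^ 2) ^ γ) (Ioo (-b) b) := fun γ =>
    (by fun_prop : Continuous (fun x : ℝ => b ^ 2 - x ^ 2)).continuousOn.rpow_const
      fun x hx => Or.inl (y_pos hx).ne'
  rcases h with h | ⟨hc, ht1, ht2, γ0, hγ0, ⟨C1, hC1⟩, ⟨C2, hC2⟩⟩
  · obtain ⟨K, hK⟩ := isCompact_Icc.exists_bound_of_continuousOn h
    have hK' : ∀ x ∈ Ioo (-b) b, |u0 x| ≤ K := fun x hx => hK x ⟨hx.1.le, hx.2.le⟩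
    refine ⟨h.mono Ioo_subset_Icc_self, ⟨K, fun x hx => (abs_le.1 (hK' x hx)).1⟩, 0, fun γ hγ => 
      ⟨K * (b ^ 2) ^ γ, fun x hx => ?_⟩⟩
    have hy := y_pos hx
    have h1 : (b ^ 2 - x ^ 2) ^ γ ≤ (b ^ 2) ^ γ :=
      Real.rpow_le_rpow hy.le (by nlinarith [sq_nonneg x]) hγ
    have h2 := hK' x hx
    have h3 : 0 ≤ K := (abs_nonneg _).trans h2
    calc u0 x * (b ^ 2 - x ^ 2) ^ γ ≤ K * (b ^ 2 - x ^ 2) ^ γ := by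
          gcongr
          exact (le_abs_self _).trans h2
      _ ≤ _ := by gcongr
  · refine ⟨hc, ?_, γ0, fun γ hγ => ?_⟩
    · obtain ⟨M, hM⟩ := bdd_of_ends hb hc.neg
        ⟨0, (ht1.eventually_ge_atTop 0).mono fun x hx => by simpa using hx⟩
        ⟨0, (ht2.eventually_ge_atTop 0).mono fun x hx => by simpa using hx⟩
      refine ⟨M, fun x hx => ?_⟩
      have := hM x hx
      simp only [Pi.neg_apply] at this
      linarith
    · refine bdd_of_ends hb (hc.mul (hycont γ)) 
        ⟨|C1| * ((2 * b) ^ (γ - γ0) * (2 * b) ^ γ), ?_⟩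
        ⟨|C2| * ((2 * b) ^ (γ - γ0) * (2 * b) ^ γ), ?_⟩
      · filter_upwards [hC1, Ioo_mem_nhdsLT (show -b < b by linarith)] with x h1 hx
        rw [show b ^ 2 - x ^ 2 = (b - x) * (b + x) by ring]
        exact end_bound (by linarith [hx.2]) (by linarith [hx.1]) (by linarith [hx.1])
          (by linarith [hx.2]) hγ0 hγ h1
      · filter_upwards [hC2, Ioo_mem_nhdsGT (show -b < b by linarith)] with x h1 hx
        rw [show b ^ 2 - x ^ 2 = (b + x) * (b - x) by ring]
        exact end_bound (by linarith [hx.1]) (by linarith [hx.2]) (by linarith [hx.2])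
          (by linarith [hx.1]) hγ0 hγ h1

end upper

/-- Elementary comparison used for the upper barriers. -/
theorem exp_compare {D l t A c h Y Z E : ℝ} (hD : 0 < D) (hl : 1 ≤ l) (ht : 0 ≤ t)
    (hA : 0 ≤ A) (hZ : 0 ≤ Z) (hE : 0 ≤ E) (hYZ : Y ≤ E * Z) (hAc : D * E ≤ A * c)
    (hch : c * Z ≤ h) :
    D * (Real.exp t - 1) * Y ≤ A * (Real.exp (l * t) - 1) * h := by
  have h1 : 0 ≤ Real.exp t - 1 := by linarith [Real.one_le_exp ht]
  have h2 : Real.exp t - 1 ≤ Real.exp (l * t) - 1 := by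
    have : Real.exp t ≤ Real.exp (l * t) := Real.exp_le_exp.2 (by nlinarith)
    linarith
  have h3 : 0 ≤ Real.exp (l * t) - 1 := h1.trans h2
  calc D * (Real.exp t - 1) * Y ≤ D * (Real.exp t - 1) * (E * Z) := by gcongr
    _ = (Real.exp t - 1) * (D * E * Z) := by ring
    _ ≤ (Real.exp (l * t) - 1) * (D * E * Z) := by gcongr
    _ ≤ (Real.exp (l * t) - 1) * (A * c * Z) := by gcongr
    _ = A * (Real.exp (l * t) - 1) * (c * Z) := by ring
    _ ≤ _ := by gcongr

theorem cont_delta {b : ℝ} {u0 : ℝ → ℝ} (hc : ContinuousOn u0 (Ioo (-b) b)) {ξ η : ℝ}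
    (hξ : ξ ∈ Ioo (-b) b) (hη : 0 < η) :
    ∃ δ > 0, ∀ x ∈ Ioo (-b) b, |x - ξ| < δ → |u0 x - u0 ξ| ≤ η := by
  obtain ⟨δ, hδ, h⟩ := Metric.continuousOn_iff.1 hc ξ hξ η hη
  exact ⟨δ, hδ, fun x hx hd => (h x hx hd).le⟩

theorem main_aux (b p ε β1 : ℝ) (u0 : ℝ → ℝ)
    (hb : 0 < b) (hp : 2 ≤ p) (hε : 0 < ε)
    (hβ1 : 0 < β1) (hβ2 : β1 * (p - 1) < 1)
    (hu0 : B1 b u0 ∨ B2 b u0) :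
    ∃ u : ℝ × ℝ → ℝ, IsVSol b (fF β1) (gG p ε) u0 u := by
  have hβlt : β1 < 1 := by nlinarith
  obtain ⟨hc, ⟨M, hM⟩, γ0, hγ0⟩ := init_facts hb hu0
  obtain ⟨γ, hγ1, hγg, hγm⟩ : ∃ γ : ℝ, 1 ≤ γ ∧ γ0 ≤ γ ∧ β1 * p / (1 - β1 * (p - 1)) ≤ γ :=
    ⟨max 1 (max γ0 (β1 * p / (1 - β1 * (p - 1)))), le_max_left _ _,
      (le_max_left _ _).trans (le_max_right _ _), (le_max_right _ _).trans (le_max_right _ _)⟩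
  have hγβ : (γ * (p - 1) + p) * β1 ≤ γ := by
    rw [div_le_iff₀ (by linarith)] at hγm
    nlinarith
  obtain ⟨C, hC⟩ := hγ0 γ hγg
  obtain ⟨w, hw1, hw2, hw3, hw4, D, hD, hw5⟩ :=
    lower_blow (b := b) (g := gG p ε) hb hβ1 hβlt hε (fun s => gG_ge hp s)
  set wM : ℝ × ℝ → ℝ := fun z => w z + (-M) with hwM
  have hM' : 0 ≤ |M| := abs_nonneg M
  have hypos : ∀ x ∈ Ioo (-b) b, 0 < b ^ 2 - x ^ 2 := fun x hx => y_pos hx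
  have hyle : ∀ x : ℝ, b ^ 2 - x ^ 2 ≤ b ^ 2 := fun x => by nlinarith [sq_nonneg x]
  set C' := |C| + |M| * (b ^ 2) ^ γ with hC'
  have hC'0 : 0 ≤ C' := by positivity
  have hbound : ∀ x ∈ Ioo (-b) b, u0 x + M ≤ C' * (b ^ 2 - x ^ 2) ^ (-γ) := by
    intro x hx
    have hy := hypos x hx
    have h1 : (b ^ 2 - x ^ 2) ^ γ ≤ (b ^ 2) ^ γ :=
      Real.rpow_le_rpow hy.le (hyle x) (by linarith)
    have h2 : (u0 x + M) * (b ^ 2 - x ^ 2) ^ γ ≤ C' := by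
      have h3 := hC x hx
      have h4 : M * (b ^ 2 - x ^ 2) ^ γ ≤ |M| * (b ^ 2) ^ γ := by
        have h6 : 0 ≤ (b ^ 2 - x ^ 2) ^ γ := by positivity
        calc M * (b ^ 2 - x ^ 2) ^ γ ≤ |M| * (b ^ 2 - x ^ 2) ^ γ :=
              mul_le_mul_of_nonneg_right (le_abs_self M) h6
          _ ≤ _ := by gcongr
      have h5 := le_abs_self C
      rw [hC']; linarith
    rw [Real.rpow_neg hy.le, ← div_eq_mul_inv, le_div_iff₀ (by positivity)]
    exact h2
  set SP : Set (ℝ × ℝ → ℝ) := {φ | (ContDiffOn ℝ 2 φ (Qset b) ∧ ContinuousOn φ (Q0set b) ∧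
    ∀ q ∈ Qset b, 0 ≤ Eop (fF β1) (gG p ε) φ q) ∧
    ∀ q ∈ Q0set b, u0 q.1 ≤ φ q ∧ wM q ≤ φ q} with hSP
  set SM : Set (ℝ × ℝ → ℝ) := {ψ | (ContDiffOn ℝ 2 ψ (Qset b) ∧ ContinuousOn ψ (Q0set b) ∧
    ∀ q ∈ Qset b, Eop (fF β1) (gG p ε) ψ q ≤ 0) ∧
    ((∀ q ∈ Q0set b, ψ q ≤ u0 q.1) ∨ (∀ q ∈ Q0set b, ψ q ≤ wM q))} with hSM
  have hQ1 : ∀ q ∈ Q0set b, q.1 ∈ Ioo (-b) b := fun q hq => hq.1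
  have hQ2 : ∀ q ∈ Q0set b, 0 ≤ q.2 := fun q hq => hq.2
  refine perron hb (fF_cont hβ1) (fF_mono hβ1) (fF_odd β1) (gG_cont hp)
    (fun s => hε.le.trans (gG_ge hp s)) (gG_even p ε) SP SM (fun φ h => h.1) (fun ψ h => h.1)
    ?_ ?_ ?_ ?_
  · rintro φ ⟨-, h1⟩ ψ ⟨-, h2 | h2⟩ q hq
    · exact (h2 q hq).trans (h1 q hq).1
    · exact (h2 q hq).trans (h1 q hq).2
  · intro ξ hξ η hη
    obtain ⟨δ, hδ, hd⟩ := cont_delta hc hξ hη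
    obtain ⟨l, c, hl, hcp, hch, hφ⟩ :=
      upper_barrier (γ := γ) hb hp hε hβ1 hβ2.le (by linarith) hγβ hξ
    set E := (b ^ 2) ^ (γ - β1) with hE
    have hE0 : 0 < E := by positivity
    obtain ⟨A, hA1, hA2, hA3⟩ : ∃ A : ℝ, 1 ≤ A ∧ C' / δ ^ 2 ≤ A ∧ D * E / c ≤ A :=
      ⟨max 1 (max (C' / δ ^ 2) (D * E / c)), le_max_left _ _,
        (le_max_left _ _).trans (le_max_right _ _), (le_max_right _ _).trans (le_max_right _ _)⟩
    rw [div_le_iff₀ (by positivity)] at hA2 hA3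
    have hA0 : 0 ≤ A := by linarith
    refine ⟨_, ⟨hφ A (u0 ξ + η - A) hA1, ?_⟩, ?_⟩
    · intro q hq
      have hx := hQ1 q hq
      have ht := hQ2 q hq
      have hy := hypos _ hx
      have hZ : 0 < (b ^ 2 - q.1 ^ 2) ^ (-γ) := by positivity
      set Z := (b ^ 2 - q.1 ^ 2) ^ (-γ) with hZd
      set hh := (q.1 - ξ) ^ 2 * Z with hhd
      have hh0 : 0 ≤ hh := by positivity
      have k1 : u0 q.1 ≤ u0 ξ + η + A * hh := by
        rcases lt_or_ge |q.1 - ξ| δ with h | h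
        · have := (abs_le.1 (hd _ hx h)).2
          have : 0 ≤ A * hh := by positivity
          linarith
        · have h1 := hbound _ hx
          have h2 : δ ^ 2 ≤ (q.1 - ξ) ^ 2 := by
            rw [← sq_abs (q.1 - ξ)]
            gcongr
          have h3 : C' * Z ≤ A * hh := by
            calc C' * Z ≤ A * δ ^ 2 * Z := by gcongr
              _ ≤ A * (q.1 - ξ) ^ 2 * Z := by gcongr
              _ = A * hh := by rw [hhd]; ring
          have h4 := hM ξ hξ
          linarith
      have hYZ : (b ^ 2 - q.1 ^ 2) ^ (-β1) ≤ E * Z := by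
        have e : (b ^ 2 - q.1 ^ 2) ^ (-β1) = (b ^ 2 - q.1 ^ 2) ^ (γ - β1) * Z := by
          rw [hZd, ← Real.rpow_add hy]; congr 1; ring
        rw [e]
        have : (b ^ 2 - q.1 ^ 2) ^ (γ - β1) ≤ E :=
          Real.rpow_le_rpow hy.le (hyle _) (by linarith)
        gcongr
      have k2 := exp_compare hD hl ht hA0 hZ.le hE0.le hYZ hA3 (hch _ hx)
      have k3 : 0 ≤ A * (Real.exp (l * q.2) - 1) * (hh + 1) := by
        have : 1 ≤ Real.exp (l * q.2) := Real.one_le_exp (by positivity)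
        have : 0 ≤ Real.exp (l * q.2) - 1 := by linarith
        positivity
      have k4 := hw5 q hq
      have k5 := hM ξ hξ
      have k6 : 0 ≤ A * hh := by positivity
      have e : A * Real.exp (l * q.2) * (hh + 1) + (u0 ξ + η - A) =
        u0 ξ + η + A * hh + A * (Real.exp (l * q.2) - 1) * (hh + 1) := by ring
      refine ⟨?_, ?_⟩
      · change u0 q.1 ≤ A * Real.exp (l * q.2) * (hh + 1) + (u0 ξ + η - A)
        rw [e]; linarith
      · change w q + (-M) ≤ A * Real.exp (l * q.2) * (hh + 1) + (u0 ξ + η - A)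
        rw [e]; linarith
    · simp
  · intro ξ hξ η hη
    obtain ⟨δ, hδ, hd⟩ := cont_delta hc hξ hη
    obtain ⟨A, hA1, hA2⟩ : ∃ A : ℝ, 0 ≤ A ∧ (u0 ξ + M) / δ ^ 2 ≤ A :=
      ⟨max 0 _, le_max_left _ _, le_max_right _ _⟩
    rw [div_le_iff₀ (by positivity)] at hA2
    obtain ⟨K, hK, h1, h2, h3⟩ := lower_quad (b := b) (fF_cont hβ1) (gG_cont (ε := ε) hp)
      (u0 ξ - η) A ξ
    refine ⟨_, ⟨⟨h1, h2, h3⟩, Or.inl ?_⟩, ?_⟩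
    · intro q hq
      have hx := hQ1 q hq
      have ht := hQ2 q hq
      have hKt : 0 ≤ K * q.2 := by positivity
      have hsq : 0 ≤ A * (q.1 - ξ) ^ 2 := by positivity
      change 1 * (-A * (q.1 - ξ) ^ 2) + (u0 ξ - η - K * q.2) ≤ u0 q.1
      rcases lt_or_ge |q.1 - ξ| δ with h | h
      · have := (abs_le.1 (hd _ hx h)).1
        linarith
      · have h5 : δ ^ 2 ≤ (q.1 - ξ) ^ 2 := by
          rw [← sq_abs (q.1 - ξ)]
          gcongr
        have h6 : A * δ ^ 2 ≤ A * (q.1 - ξ) ^ 2 := by gcongr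
        have h7 := hM _ hx
        linarith
    · simp
  · refine ⟨wM, ⟨⟨hw1.add contDiffOn_const, hw2.add continuousOn_const, fun q hq => ?_⟩,
      Or.inr fun q _ => le_rfl⟩, fun t ht => ?_⟩
    · rw [hwM, Eop_add_const]
      exact hw3 q hq
    · exact ⟨tendsto_atTop_add_const_right _ _ (hw4 t ht).1,
        tendsto_atTop_add_const_right _ _ (hw4 t ht).2⟩

/-- global existence for the `p`-Laplace type heat equation when
`0 < β₁ < 1/(p-1)` under (B1) or (B2). -/
theorem pLaplace_existence (b p ε β1 : ℝ) (u0 : ℝ → ℝ)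
    (hb : 0 < b) (hp : 2 ≤ p) (hε : 0 < ε)
    (hβ1 : 0 < β1) (hβ1' : β1 < 1 / (p - 1))
    (hu0 : B1 b u0 ∨ B2 b u0) :
    ∃ u : ℝ × ℝ → ℝ,
      IsVSol b (fun s => |s| ^ (β1 - 1) * s)
        (fun s => (p - 1) * |s| ^ (p - 2) + ε) u0 u := by
  have hp1 : 0 < p - 1 := by linarith
  exact main_aux b p ε β1 u0 hb hp hε hβ1 ((lt_div_iff₀ hp1).1 hβ1') hu0
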